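/- arXiv:2508.06705 — 3 statements merged into one kernel-verified Lean document; each statement's English description precedes it below -/
import Mathlib

section
/- Fix i ∈ {1,2}. There exist nonzero polynomials R₁, R₂ ∈ ℝ[r₁,s₁,r₂,s₂] with the following properties, where for parameters (r_j,s_j) we write V_j^{(λ)} = Ad((u^{(i)}_{r_j,s_j})ᵀ)(𝔯ᵢ^{(λ)}). (1) For all (r₁,s₁,r₂,s₂) ∈ ℝ⁴: dim(𝔯ᵢ^{(1)} + V₁^{(1)} + V₂^{(1)}) = 8 if and only if R₁(r₁,s₁,r₂,s₂) ≠ 0. (2) For all (r₁,s₁,r₂,s₂) ∈ ℝ⁴: dim(𝔯ᵢ^{(0)} ∩ V₁^{(0)} ∩ V₂^{(0)}) = 1 if and only if R₂(r₁,s₁,r₂,s₂) ≠ 0. In particular, each of these conditions holds on a dense Zariski-open set of parameters. -/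
open Matrix MeasureTheory
open scoped Classical

noncomputable section

abbrev M4 : Type := Matrix (Fin 4) (Fin 4) ℝ

/-- trace inner product ⟨X,Y⟩ = tr(XYᵀ) -/
def tinner (X Y : M4) : ℝ := (X * Yᵀ).trace

/-- sup norm: maximum absolute value of entries -/
def mnorm (X : M4) : ℝ := ⨆ p : Fin 4 × Fin 4, |X p.1 p.2|

/-- Euclidean (Frobenius) norm -/
def mnorm2 (X : M4) : ℝ := Real.sqrt (tinner X X)

/-- Gram matrices Q₁ (i=0) and Q₂ (i=1) -/
def Qmat (i : Fin 2) : M4 :=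
  if i = 0 then !![0,0,0,-(1/2); 0,0,1/2,0; 0,1/2,0,0; -(1/2),0,0,0]
  else !![0,0,0,-1; 0,1,0,0; 0,0,1,0; -1,0,0,0]

/-- 𝔰𝔩₄(ℝ) as a submodule of 4×4 matrices -/
def sl4 : Submodule ℝ M4 where
  carrier := {X | X.trace = 0}
  add_mem' := by
    intro a b ha hb
    simp only [Set.mem_setOf_eq] at *
    simp [Matrix.trace_add, ha, hb]
  zero_mem' := by simp
  smul_mem' := by
    intro c x hx
    simp only [Set.mem_setOf_eq] at *
    simp [Matrix.trace_smul, hx]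

/-- the involution σᵢ(X) = −QᵢXᵀQᵢ⁻¹ as a linear map -/
def sigmaMap (i : Fin 2) : M4 →ₗ[ℝ] M4 where
  toFun X := -(Qmat i * Xᵀ * (Qmat i)⁻¹)
  map_add' X Y := by
    simp [Matrix.transpose_add, add_mul, mul_add]; abel
  map_smul' c X := by
    simp [Matrix.transpose_smul, Matrix.smul_mul, Matrix.mul_smul]

/-- 𝔯ᵢ = {X ∈ 𝔰𝔩₄ : σᵢ(X) = −X} -/
def rSpace (i : Fin 2) : Submodule ℝ M4 :=
  sl4 ⊓ LinearMap.ker (sigmaMap i + (LinearMap.id : M4 →ₗ[ℝ] M4))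

/-- 𝔥ᵢ = {X ∈ 𝔰𝔩₄ : σᵢ(X) = X} -/
def hSpace (i : Fin 2) : Submodule ℝ M4 :=
  sl4 ⊓ LinearMap.ker (sigmaMap i - (LinearMap.id : M4 →ₗ[ℝ] M4))

/-- 𝐚 = diag(1,0,0,−1) -/
def aWt : M4 := Matrix.diagonal ![1,0,0,-1]

/-- ad(𝐚) = [𝐚, ·] -/
def adA : M4 →ₗ[ℝ] M4 where
  toFun X := aWt * X - X * aWt
  map_add' X Y := by simp [mul_add, add_mul]; abel
  map_smul' c X := by simp [Matrix.mul_smul, Matrix.smul_mul, smul_sub]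

/-- weight space (𝔯ᵢ)_λ -/
def wSpace (i : Fin 2) (lam : ℤ) : Submodule ℝ M4 :=
  rSpace i ⊓ LinearMap.ker (adA - (lam : ℝ) • (LinearMap.id : M4 →ₗ[ℝ] M4))

/-- 𝔯ᵢ^{(λ)} = ⊕_{μ ≥ λ} (𝔯ᵢ)_μ -/
def rUp (i : Fin 2) (lam : ℤ) : Submodule ℝ M4 :=
  ⨆ (μ : ℤ) (_ : lam ≤ μ), wSpace i μ

/-- a_t = diag(e^t, 1, 1, e^{−t}) -/
def aMat (t : ℝ) : M4 := Matrix.diagonal ![Real.exp t, 1, 1, Real.exp (-t)]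

/-- the unipotent elements u^{(i)}_{r,s} -/
def uMat (i : Fin 2) (r s : ℝ) : M4 :=
  if i = 0 then !![1, r, s, s*r; 0,1,0,s; 0,0,1,r; 0,0,0,1]
  else !![1, r, s, (r^2+s^2)/2; 0,1,0,r; 0,0,1,s; 0,0,0,1]

/-- adjoint action g.X = gXg⁻¹ -/
def Adm (g X : M4) : M4 := g * X * g⁻¹

/-- adjoint action as a linear map -/
def AdLin (g : M4) : M4 →ₗ[ℝ] M4 where
  toFun X := g * X * g⁻¹
  map_add' X Y := by simp [mul_add, add_mul]
  map_smul' c X := by simp [Matrix.mul_smul, Matrix.smul_mul]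

/-- the parameter square [−1,1]² -/
def uSq : Set (ℝ × ℝ) := Set.Icc (-1 : ℝ) 1 ×ˢ Set.Icc (-1 : ℝ) 1

/-- m_U = (1/4)·(Lebesgue measure in the parameters) -/
def mU (S : Set (ℝ × ℝ)) : ENNReal := volume S / 4

/-- modified α-energy 𝒢^{(α)}_{F,δ}(w) -/
def energy (α δ : ℝ) (F : Finset M4) (w : M4) : ℝ :=
  ∑ w' ∈ F.erase w, (max (mnorm (w' - w)) δ) ^ (-α)

/-- φ(α) = (1/36)·min{(8/9)α, 1 − α/9} -/
def phiFn (α : ℝ) : ℝ := (1/36) * min ((8/9)*α) (1 - α/9)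

/-- δ-covering number by closed balls for the sup norm -/
def covNum (δ : ℝ) (A : Set M4) : ℕ :=
  sInf {n : ℕ | ∃ t : Finset M4, t.card = n ∧ A ⊆ ⋃ c ∈ t, {y : M4 | mnorm (y - c) ≤ δ}}

/-- orthonormal basis of a subspace, as a tuple -/
def IsONB {n : Type} [Fintype n] (v : n → M4) (V : Submodule ℝ M4) : Prop :=
  (∀ k, v k ∈ V) ∧ (∀ k l, tinner (v k) (v l) = if k = l then 1 else 0) ∧
    Submodule.span ℝ (Set.range v) = V

/-- Gram matrix of a tuple of vectors -/
def gram {n : Type} [Fintype n] (v : n → M4) : Matrix n n ℝ :=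
  Matrix.of fun a b => tinner (v a) (v b)

/-- weights λ₁,…,λ₅ = −2,…,2 -/
def lamOf : Fin 5 → ℤ := ![-2,-1,0,1,2]

/-- dimension differences 𝖽 = (1,2,3,2,1) -/
def dOf : Fin 5 → ℝ := ![1,2,3,2,1]

/-- Index of the atom of 𝒟^𝐫_ρ containing x, for an adapted orthonormal basis b with weights wt. -/
def atomIdx (b : Fin 9 → M4) (wt : Fin 9 → ℤ) (r : Fin 5 → ℝ) (ρ : ℝ) (x : M4) :
    Fin 5 → Fin 9 → ℤ :=
  fun j k => if lamOf j ≤ wt k then ⌊ tinner x (b k) / ρ ^ (r j) ⌋ else 0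

end

theorem finrank_ker_mulVecLin_eq_one_iff {K n : Type*} [Field K] [Fintype n] [DecidableEq n]
    {M : Matrix n n K} (hM : M.det = 0) :
    Module.finrank K (LinearMap.ker M.mulVecLin) = 1 ↔ M.adjugate ≠ 0 := by
  have key : ∀ i j, M.adjugate i j = 0 ↔ ∃ v, v ≠ 0 ∧ v i = 0 ∧ ∀ k, k ≠ j → (M *ᵥ v) k = 0 := by
    intro i j
    rw [Matrix.adjugate_apply, ← Matrix.exists_mulVec_eq_zero_iff]
    refine exists_congr fun v => and_congr_right fun _ => ?_
    have hrow : ∀ k, (M.updateRow j (Pi.single i 1) *ᵥ v) k = if k = j then v i else (M *ᵥ v) k := by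
      intro k
      split_ifs with h
      · simp [Matrix.mulVec, h]
      · simp [Matrix.mulVec, h]
    rw [funext_iff]
    constructor
    · intro h
      exact ⟨by simpa using (hrow j).symm.trans (h j),
        fun k hk => by simpa [hk] using (hrow k).symm.trans (h k)⟩
    · rintro ⟨h1, h2⟩ k
      rw [hrow]
      split_ifs with h
      · exact h1
      · exact h2 k h
  obtain ⟨v, hv, hMv⟩ := Matrix.exists_mulVec_eq_zero_iff.mpr hM
  rw [finrank_eq_one_iff']
  constructor
  · rintro ⟨⟨x, hx⟩, hx0, hspan⟩ hadj
    obtain ⟨w, hw, hMw⟩ := Matrix.exists_vecMul_eq_zero_iff.mpr hM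
    obtain ⟨i, hi⟩ := Function.ne_iff.mp (fun h => hx0 (Subtype.ext h) : x ≠ 0)
    obtain ⟨j, hj⟩ := Function.ne_iff.mp hw
    obtain ⟨y, hy, hyi, hyk⟩ := (key i j).mp (by simp [hadj])
    have hyM : M *ᵥ y = 0 := by
      have h0 : w ⬝ᵥ (M *ᵥ y) = 0 := by rw [Matrix.dotProduct_mulVec, hMw, zero_dotProduct]
      rw [dotProduct, Finset.sum_eq_single j (fun k _ hk => by rw [hyk k hk, mul_zero])
        (by simp)] at h0
      ext k
      by_cases hk : k = j
      · subst hk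
        exact (mul_eq_zero.mp h0).resolve_left hj
      · exact hyk k hk
    obtain ⟨c, hc⟩ := hspan ⟨y, by simpa using hyM⟩
    have hc' : c • x = y := congrArg Subtype.val hc
    have : c = 0 := by
      have h1 := congrFun hc' i
      rw [hyi, Pi.smul_apply, smul_eq_mul] at h1
      exact (mul_eq_zero.mp h1).resolve_right hi
    exact hy (by rw [← hc', this, zero_smul])
  · intro hadj
    obtain ⟨i, j, hij⟩ : ∃ i j, M.adjugate i j ≠ 0 := by
      by_contra! h
      exact hadj (Matrix.ext h)
    have hinj : ∀ y, M *ᵥ y = 0 → y i = 0 → y = 0 := by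
      intro y hy hyi
      by_contra hy0
      exact hij ((key i j).mpr ⟨y, hy0, hyi, fun k _ => by simp [hy]⟩)
    have hvi : v i ≠ 0 := fun h => hv (hinj v hMv h)
    refine ⟨⟨v, by simpa using hMv⟩, fun h => hv (congrArg Subtype.val h), ?_⟩
    rintro ⟨y, hy⟩
    have hy' : M *ᵥ y = 0 := by simpa using hy
    refine ⟨y i / v i, Subtype.ext ?_⟩
    have := hinj (y - (y i / v i) • v)
      (by rw [Matrix.mulVec_sub, Matrix.mulVec_smul, hMv, hy', smul_zero, sub_zero])
      (by simp [hvi])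
    exact (sub_eq_zero.mp this).symm

/-- The trace form `(X, Y) ↦ tr (XY)`. -/
def trForm : LinearMap.BilinForm ℝ M4 :=
  LinearMap.mk₂ ℝ (fun X Y => (X * Y).trace)
    (by simp [add_mul]) (by simp) (by simp [mul_add]) (by simp)

theorem trForm_apply (X Y : M4) : trForm X Y = (X * Y).trace := rfl

theorem trForm_isSymm : trForm.IsSymm := ⟨fun X Y => Matrix.trace_mul_comm X Y⟩

theorem trForm_nondegenerate : trForm.Nondegenerate :=
  ⟨fun X h => Matrix.ext_iff_trace_mul_right.mpr fun Y => by
      simpa [trForm_apply] using h Y,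
    fun X h => Matrix.ext_iff_trace_mul_left.mpr fun Y => by
      simpa [trForm_apply] using h Y⟩

theorem isUnit_det_Qmat (i : Fin 2) : IsUnit (Qmat i).det := by
  fin_cases i <;> simp [Qmat, Matrix.det_succ_row_zero, Fin.sum_univ_succ, Fin.succAbove]

theorem transpose_Qmat (i : Fin 2) : (Qmat i)ᵀ = Qmat i := by
  fin_cases i <;> ext a b <;> fin_cases a <;> fin_cases b <;> simp [Qmat]

theorem mem_rSpace_iff {i : Fin 2} {X : M4} :
    X ∈ rSpace i ↔ X.trace = 0 ∧ X * Qmat i = Qmat i * Xᵀ := by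
  have hu := isUnit_det_Qmat i
  refine and_congr_right fun _ => ?_
  change -(Qmat i * Xᵀ * (Qmat i)⁻¹) + X = 0 ↔ _
  rw [neg_add_eq_zero]
  constructor
  · intro h
    nth_rw 1 [← h]
    rw [Matrix.mul_assoc, Matrix.nonsing_inv_mul _ hu, Matrix.mul_one]
  · intro h
    rw [← h, Matrix.mul_assoc, Matrix.mul_nonsing_inv _ hu, Matrix.mul_one]

/-- Coordinates on `rSpace i`. -/
def rCoord (i : Fin 2) : (Fin 9 → ℝ) →ₗ[ℝ] M4 where
  toFun c :=
    if i = 0 then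
      !![c 0, c 1, c 2, c 3; c 6, -c 0, c 4, -c 2; c 7, c 5, -c 0, -c 1; c 8, -c 7, -c 6, c 0]
    else
      !![c 0, c 1, c 2, c 3; c 6, -c 0 + c 4, c 5, -c 1; c 7, c 5, -c 0 - c 4, -c 2;
        c 8, -c 6, -c 7, c 0]
  map_add' x y := by
    split_ifs <;> ext a b <;> fin_cases a <;> fin_cases b <;> simp <;> ring
  map_smul' x y := by
    split_ifs <;> ext a b <;> fin_cases a <;> fin_cases b <;> simp <;> ring

theorem rCoord_injective (i : Fin 2) : Function.Injective (rCoord i) := by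
  intro x y h
  have h' := fun a b => congrFun (congrFun h a) b
  have h0 := h' 0 0
  have h1 := h' 0 1
  have h2 := h' 0 2
  have h3 := h' 0 3
  have h4 := h' 1 0
  have h5 := h' 2 0
  have h6 := h' 3 0
  have h7 := h' 1 1
  have h8 := h' 1 2
  have h9 := h' 2 1
  clear h h'
  fin_cases i <;> simp [rCoord] at h0 h1 h2 h3 h4 h5 h6 h7 h8 h9 <;>
    ext k <;> fin_cases k <;> simp <;> linarith

theorem range_rCoord (i : Fin 2) : LinearMap.range (rCoord i) = rSpace i := by
  ext X
  rw [mem_rSpace_iff, LinearMap.mem_range]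
  constructor
  · rintro ⟨c, rfl⟩
    fin_cases i
    · refine ⟨by simp [rCoord, Matrix.trace, Fin.sum_univ_succ], ?_⟩
      ext a b
      fin_cases a <;> fin_cases b <;>
        simp [rCoord, Qmat, Matrix.mul_apply, Fin.sum_univ_succ, mul_comm]
    · refine ⟨by simp [rCoord, Matrix.trace, Fin.sum_univ_succ]; ring, ?_⟩
      ext a b
      fin_cases a <;> fin_cases b <;>
        simp [rCoord, Qmat, Matrix.mul_apply, Fin.sum_univ_succ]
  · rintro ⟨ht, hX⟩
    have hX' := fun a b => congrFun (congrFun hX a) b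
    have e01 := hX' 0 1
    have e02 := hX' 0 2
    have e03 := hX' 0 3
    have e12 := hX' 1 2
    have e13 := hX' 1 3
    have e23 := hX' 2 3
    clear hX hX'
    fin_cases i
    · simp [Qmat, Matrix.mul_apply, Matrix.trace, Fin.sum_univ_succ] at ht e01 e02 e03 e12 e13 e23
      refine ⟨![X 0 0, X 0 1, X 0 2, X 0 3, X 1 2, X 2 1, X 1 0, X 2 0, X 3 0], ?_⟩
      ext a b
      fin_cases a <;> fin_cases b <;> simp [rCoord] <;> linarith
    · simp [Qmat, Matrix.mul_apply, Matrix.trace, Fin.sum_univ_succ] at ht e01 e02 e03 e12 e13 e23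
      refine ⟨![X 0 0, X 0 1, X 0 2, X 0 3, X 1 1 + X 0 0, X 1 2, X 1 0, X 2 0, X 3 0], ?_⟩
      ext a b
      fin_cases a <;> fin_cases b <;> simp [rCoord] <;> linarith

theorem finrank_rSpace (i : Fin 2) : Module.finrank ℝ (rSpace i) = 9 := by
  rw [← range_rCoord, LinearMap.finrank_range_of_inj (rCoord_injective i)]
  simp

theorem transpose_mem_rSpace {i : Fin 2} {X : M4} (hX : X ∈ rSpace i) : Xᵀ ∈ rSpace i := by
  rw [← range_rCoord] at hX ⊢
  obtain ⟨c, rfl⟩ := hX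
  fin_cases i
  · refine ⟨![c 0, c 6, c 7, c 8, c 5, c 4, c 1, c 2, c 3], ?_⟩
    ext a b
    fin_cases a <;> fin_cases b <;> simp [rCoord]
  · refine ⟨![c 0, c 6, c 7, c 8, c 4, c 5, c 1, c 2, c 3], ?_⟩
    ext a b
    fin_cases a <;> fin_cases b <;> simp [rCoord]

theorem disjoint_rSpace_orthogonal (i : Fin 2) :
    Disjoint (rSpace i) (trForm.orthogonal (rSpace i)) := by
  rw [Submodule.disjoint_def]
  intro X hX hX'
  have h : trForm Xᵀ X = 0 := hX' _ (transpose_mem_rSpace hX)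
  rw [trForm_apply] at h
  exact Matrix.trace_conjTranspose_mul_self_eq_zero_iff.mp
    (by rwa [Matrix.conjTranspose_eq_transpose_of_trivial])

/-- Duality in `rSpace i` with respect to the trace form. -/
theorem finrank_add_finrank_rSpace_inf_orthogonal {i : Fin 2} {W : Submodule ℝ M4}
    (hW : W ≤ rSpace i) :
    Module.finrank ℝ W + Module.finrank ℝ ↥(rSpace i ⊓ trForm.orthogonal W) = 9 := by
  have hrefl : trForm.IsRefl := trForm_isSymm.isRefl
  set P := trForm.orthogonal (rSpace i) with hP
  have hinf : rSpace i ⊓ trForm.orthogonal W = trForm.orthogonal (P ⊔ W) := by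
    apply le_antisymm
    · rintro X ⟨hX, hXW⟩ Y hY
      obtain ⟨p, hp, w, hw, rfl⟩ := Submodule.mem_sup.mp hY
      have h1 : trForm p X = 0 := hrefl _ _ (hp X hX)
      have h2 : trForm w X = 0 := hXW w hw
      change trForm (p + w) X = 0
      rw [map_add, LinearMap.add_apply, h1, h2, add_zero]
    · refine le_inf ?_ (LinearMap.BilinForm.orthogonal_le le_sup_right)
      rw [← LinearMap.BilinForm.orthogonal_orthogonal trForm_nondegenerate hrefl (rSpace i)]
      exact LinearMap.BilinForm.orthogonal_le le_sup_left
  have hfin : Module.finrank ℝ M4 = 16 := by simp [M4, Module.finrank_matrix]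
  have h1 := Submodule.finrank_sup_add_finrank_inf_eq P W
  have h2 : P ⊓ W = ⊥ := ((disjoint_rSpace_orthogonal i).symm.mono_right hW).eq_bot
  have h3 := LinearMap.BilinForm.finrank_orthogonal trForm_nondegenerate (rSpace i)
  have h4 := LinearMap.BilinForm.finrank_orthogonal trForm_nondegenerate (P ⊔ W)
  have h5 := Submodule.finrank_le (P ⊔ W)
  rw [h2, finrank_bot] at h1
  rw [finrank_rSpace, hfin, ← hP] at h3
  rw [hinf, h4]
  omega

/-- The `ad 𝐚`-weights of the coordinates on `rSpace i`. -/
def rWeight : Fin 9 → ℤ := ![0, 1, 1, 2, 0, 0, -1, -1, -2]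

theorem adA_rCoord (i : Fin 2) (c : Fin 9 → ℝ) :
    adA (rCoord i c) = rCoord i (fun k => rWeight k * c k) := by
  fin_cases i <;> ext a b <;> fin_cases a <;> fin_cases b <;>
    simp [adA, aWt, rCoord, rWeight, Matrix.vecMul_diagonal] <;> ring

theorem rCoord_mem_rSpace (i : Fin 2) (c : Fin 9 → ℝ) : rCoord i c ∈ rSpace i := by
  rw [← range_rCoord]
  exact ⟨c, rfl⟩

theorem rCoord_mem_wSpace_iff {i : Fin 2} {c : Fin 9 → ℝ} {μ : ℤ} :
    rCoord i c ∈ wSpace i μ ↔ ∀ k, rWeight k ≠ μ → c k = 0 := by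
  have h : rCoord i c ∈ wSpace i μ ↔ adA (rCoord i c) = (μ : ℝ) • rCoord i c := by
    simp [wSpace, rCoord_mem_rSpace, sub_eq_zero]
  rw [h, adA_rCoord, ← map_smul, (rCoord_injective i).eq_iff, funext_iff]
  refine forall_congr' fun k => ?_
  rw [Pi.smul_apply, smul_eq_mul, mul_eq_mul_right_iff, Int.cast_inj, or_iff_not_imp_left]

theorem mem_rUp_iff {i : Fin 2} {lam : ℤ} {X : M4} :
    X ∈ rUp i lam ↔ ∃ c, (∀ k, rWeight k < lam → c k = 0) ∧ rCoord i c = X := by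
  constructor
  · intro hX
    let S : Submodule ℝ (Fin 9 → ℝ) :=
      { carrier := {c | ∀ k, rWeight k < lam → c k = 0}
        add_mem' := fun ha hb k hk => by simp [ha k hk, hb k hk]
        zero_mem' := fun _ _ => rfl
        smul_mem' := fun t c hc k hk => by simp [hc k hk] }
    have hle : rUp i lam ≤ S.map (rCoord i) := by
      refine iSup₂_le fun μ hμ Y hY => ?_
      obtain ⟨c, rfl⟩ : Y ∈ LinearMap.range (rCoord i) := by
        rw [range_rCoord]
        exact hY.1
      exact ⟨c, fun k hk => rCoord_mem_wSpace_iff.mp hY k (by omega), rfl⟩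
    exact hle hX
  · rintro ⟨c, hc, rfl⟩
    have hsum : c = ∑ k, Pi.single k (c k) := (Finset.univ_sum_single c).symm
    rw [hsum, map_sum]
    refine Submodule.sum_mem _ fun k _ => ?_
    by_cases hk : rWeight k < lam
    · simp [hc k hk]
    · refine Submodule.mem_iSup_of_mem (rWeight k) (Submodule.mem_iSup_of_mem (not_lt.mp hk) ?_)
      refine rCoord_mem_wSpace_iff.mpr fun l hl => Pi.single_eq_of_ne ?_ _
      rintro rfl
      exact hl rfl

theorem rUp_le_rSpace (i : Fin 2) (lam : ℤ) : rUp i lam ≤ rSpace i :=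
  iSup₂_le fun _ _ => inf_le_left

theorem mem_rUp_zero_iff {i : Fin 2} {X : M4} :
    X ∈ rUp i 0 ↔ X ∈ rSpace i ∧ X 1 0 = 0 ∧ X 2 0 = 0 ∧ X 3 0 = 0 := by
  have hcoord : ∀ c : Fin 9 → ℝ, rCoord i c 1 0 = c 6 ∧ rCoord i c 2 0 = c 7 ∧
      rCoord i c 3 0 = c 8 := by
    intro c
    fin_cases i <;> simp [rCoord]
  rw [mem_rUp_iff]
  constructor
  · rintro ⟨c, hc, rfl⟩
    obtain ⟨h6, h7, h8⟩ := hcoord c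
    rw [h6, h7, h8]
    exact ⟨rCoord_mem_rSpace i c, hc 6 (by decide), hc 7 (by decide), hc 8 (by decide)⟩
  · rintro ⟨hX, h⟩
    rw [← range_rCoord] at hX
    obtain ⟨c, rfl⟩ := hX
    obtain ⟨h6, h7, h8⟩ := hcoord c
    rw [h6, h7, h8] at h
    refine ⟨c, fun k hk => ?_, rfl⟩
    fin_cases k <;> simp [rWeight] at hk
    exacts [h.1, h.2.1, h.2.2]

theorem trForm_rCoord {i : Fin 2} {d : Fin 9 → ℝ} (hd : ∀ k, rWeight k < 1 → d k = 0)
    (c : Fin 9 → ℝ) :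
    trForm (rCoord i d) (rCoord i c) = 2 * (d 1 * c 6) + 2 * (d 2 * c 7) + d 3 * c 8 := by
  have h0 := hd 0 (by decide)
  have h4 := hd 4 (by decide)
  have h5 := hd 5 (by decide)
  have h6 := hd 6 (by decide)
  have h7 := hd 7 (by decide)
  have h8 := hd 8 (by decide)
  fin_cases i <;>
    simp [trForm_apply, rCoord, Matrix.trace, Fin.sum_univ_succ,
      h0, h4, h5, h6, h7, h8] <;> ring

theorem rUp_zero_eq (i : Fin 2) : rUp i 0 = rSpace i ⊓ trForm.orthogonal (rUp i 1) := by
  ext X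
  constructor
  · intro hX
    refine ⟨rUp_le_rSpace i 0 hX, fun Y hY => ?_⟩
    obtain ⟨c, hc, rfl⟩ := mem_rUp_iff.mp hX
    obtain ⟨d, hd, rfl⟩ := mem_rUp_iff.mp hY
    change trForm _ _ = 0
    rw [trForm_rCoord hd, hc 6 (by decide), hc 7 (by decide), hc 8 (by decide)]
    ring
  · rintro ⟨hX, hXo⟩
    replace hX : X ∈ rSpace i := hX
    rw [← range_rCoord] at hX
    obtain ⟨c, rfl⟩ := hX
    have hsingle : ∀ k, 1 ≤ rWeight k → trForm (rCoord i (Pi.single k 1)) (rCoord i c) = 0 ∧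
        ∀ l, rWeight l < 1 → (Pi.single k 1 : Fin 9 → ℝ) l = 0 := by
      intro k hk
      have hs : ∀ l, rWeight l < 1 → (Pi.single k 1 : Fin 9 → ℝ) l = 0 := by
        intro l hl
        refine Pi.single_eq_of_ne ?_ _
        rintro rfl
        omega
      exact ⟨hXo _ (mem_rUp_iff.mpr ⟨_, hs, rfl⟩), hs⟩
    obtain ⟨e1, s1⟩ := hsingle 1 (by decide)
    obtain ⟨e2, s2⟩ := hsingle 2 (by decide)
    obtain ⟨e3, s3⟩ := hsingle 3 (by decide)
    rw [trForm_rCoord s1] at e1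
    rw [trForm_rCoord s2] at e2
    rw [trForm_rCoord s3] at e3
    refine mem_rUp_iff.mpr ⟨c, fun k hk => ?_, rfl⟩
    fin_cases k <;> simp [rWeight] at hk e1 e2 e3 <;> assumption

theorem uMat_mul_uMat_neg (i : Fin 2) (r s : ℝ) : uMat i r s * uMat i (-r) (-s) = 1 := by
  fin_cases i <;> ext a b <;> fin_cases a <;> fin_cases b <;>
    simp [uMat, Matrix.mul_apply, Fin.sum_univ_succ] <;> ring

theorem inv_transpose_uMat (i : Fin 2) (r s : ℝ) :
    ((uMat i r s)ᵀ)⁻¹ = (uMat i (-r) (-s))ᵀ := by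
  refine Matrix.inv_eq_left_inv ?_
  rw [← Matrix.transpose_mul, uMat_mul_uMat_neg, Matrix.transpose_one]

theorem isUnit_det_transpose_uMat (i : Fin 2) (r s : ℝ) : IsUnit ((uMat i r s)ᵀ).det := by
  rw [Matrix.det_transpose]
  exact Matrix.isUnit_det_of_right_inverse (uMat_mul_uMat_neg i r s)

theorem transpose_uMat_mul_Qmat_mul (i : Fin 2) (r s : ℝ) :
    (uMat i r s)ᵀ * Qmat i * uMat i r s = Qmat i := by
  fin_cases i <;> ext a b <;> fin_cases a <;> fin_cases b <;>
    simp [uMat, Qmat, Matrix.mul_apply, Fin.sum_univ_succ] <;> ring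

theorem mem_map_AdLin_iff {g : M4} (hg : IsUnit g.det) {W : Submodule ℝ M4} {X : M4} :
    X ∈ W.map (AdLin g) ↔ AdLin g⁻¹ X ∈ W := by
  have h1 : ∀ Y, AdLin g⁻¹ (AdLin g Y) = Y := fun Y => by
    simp only [AdLin, LinearMap.coe_mk, AddHom.coe_mk, Matrix.nonsing_inv_nonsing_inv g hg]
    rw [Matrix.mul_assoc g, Matrix.nonsing_inv_mul_cancel_left _ _ hg, Matrix.mul_assoc,
      Matrix.nonsing_inv_mul _ hg, Matrix.mul_one]
  have h2 : ∀ Y, AdLin g (AdLin g⁻¹ Y) = Y := fun Y => by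
    simp only [AdLin, LinearMap.coe_mk, AddHom.coe_mk, Matrix.nonsing_inv_nonsing_inv g hg]
    rw [Matrix.mul_assoc g⁻¹, Matrix.mul_nonsing_inv_cancel_left _ _ hg, Matrix.mul_assoc,
      Matrix.mul_nonsing_inv _ hg, Matrix.mul_one]
  constructor
  · rintro ⟨Y, hY, rfl⟩
    rwa [h1]
  · intro h
    exact ⟨_, h, h2 X⟩

theorem trForm_AdLin {g : M4} (hg : IsUnit g.det) (X Y : M4) :
    trForm (AdLin g X) Y = trForm X (AdLin g⁻¹ Y) := by
  simp only [trForm_apply, AdLin, LinearMap.coe_mk, AddHom.coe_mk,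
    Matrix.nonsing_inv_nonsing_inv g hg]
  rw [Matrix.mul_assoc, Matrix.mul_assoc, Matrix.trace_mul_comm]
  simp only [Matrix.mul_assoc]

theorem AdLin_transpose_uMat_mem_rSpace {i : Fin 2} {X : M4} (r s : ℝ) (hX : X ∈ rSpace i) :
    AdLin (uMat i r s)ᵀ X ∈ rSpace i := by
  have hu := isUnit_det_transpose_uMat i r s
  rw [mem_rSpace_iff] at hX ⊢
  obtain ⟨ht, hQ⟩ := hX
  set g := (uMat i r s)ᵀ with hgdef
  have hg : g * Qmat i * gᵀ = Qmat i := transpose_uMat_mul_Qmat_mul i r s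
  have h1 : g⁻¹ * Qmat i = Qmat i * gᵀ := by
    nth_rw 1 [← hg]
    rw [Matrix.mul_assoc g, Matrix.nonsing_inv_mul_cancel_left _ _ hu]
  have h2 : Qmat i * g⁻¹ᵀ = g * Qmat i := by
    simpa [Matrix.transpose_mul, transpose_Qmat] using congrArg Matrix.transpose h1
  change (g * X * g⁻¹).trace = 0 ∧ g * X * g⁻¹ * Qmat i = Qmat i * (g * X * g⁻¹)ᵀ
  constructor
  · rw [Matrix.trace_mul_comm, Matrix.nonsing_inv_mul_cancel_left _ _ hu, ht]
  · rw [Matrix.mul_assoc (g * X), h1, Matrix.transpose_mul, ← Matrix.mul_assoc (Qmat i), h2,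
      Matrix.transpose_mul, Matrix.mul_assoc g X, ← Matrix.mul_assoc X, hQ]
    simp only [Matrix.mul_assoc]

theorem map_AdLin_rSpace_inf_orthogonal {i : Fin 2} (r s : ℝ) (W : Submodule ℝ M4) :
    (rSpace i ⊓ trForm.orthogonal W).map (AdLin (uMat i r s)ᵀ) =
      rSpace i ⊓ trForm.orthogonal (W.map (AdLin (uMat i r s)ᵀ)) := by
  have hu := isUnit_det_transpose_uMat i r s
  ext X
  rw [mem_map_AdLin_iff hu, Submodule.mem_inf, Submodule.mem_inf]
  refine and_congr ⟨fun h => ?_, fun h => ?_⟩ ⟨fun h => ?_, fun h Y hY => ?_⟩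
  · obtain ⟨Y, hY, rfl⟩ := (mem_map_AdLin_iff hu).mpr h
    exact AdLin_transpose_uMat_mem_rSpace r s hY
  · rw [inv_transpose_uMat]
    exact AdLin_transpose_uMat_mem_rSpace _ _ h
  · rintro _ ⟨Y, hY, rfl⟩
    exact (trForm_AdLin hu Y X).trans (h Y hY)
  · exact (trForm_AdLin hu Y X).symm.trans (h _ (Submodule.mem_map_of_mem hY))

theorem finrank_sup_add_finrank_inf (i : Fin 2) (r₁ s₁ r₂ s₂ : ℝ) :
    Module.finrank ℝ
        ↥(rUp i 1 ⊔ Submodule.map (AdLin (uMat i r₁ s₁)ᵀ) (rUp i 1) ⊔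
          Submodule.map (AdLin (uMat i r₂ s₂)ᵀ) (rUp i 1)) +
      Module.finrank ℝ
        ↥(rUp i 0 ⊓ Submodule.map (AdLin (uMat i r₁ s₁)ᵀ) (rUp i 0) ⊓
          Submodule.map (AdLin (uMat i r₂ s₂)ᵀ) (rUp i 0)) = 9 := by
  have hmap : ∀ r s : ℝ, (rUp i 1).map (AdLin (uMat i r s)ᵀ) ≤ rSpace i := by
    rintro r s _ ⟨X, hX, rfl⟩
    exact AdLin_transpose_uMat_mem_rSpace r s (rUp_le_rSpace i 1 hX)
  have hsup : ∀ V W : Submodule ℝ M4, trForm.orthogonal (V ⊔ W) =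
      trForm.orthogonal V ⊓ trForm.orthogonal W := by
    intro V W
    refine le_antisymm (le_inf (LinearMap.BilinForm.orthogonal_le le_sup_left)
      (LinearMap.BilinForm.orthogonal_le le_sup_right)) ?_
    rintro X ⟨hV, hW⟩ Y hY
    obtain ⟨v, hv, w, hw, rfl⟩ := Submodule.mem_sup.mp hY
    have h1 : trForm v X = 0 := hV v hv
    have h2 : trForm w X = 0 := hW w hw
    change trForm (v + w) X = 0
    rw [map_add, LinearMap.add_apply, h1, h2, add_zero]
  rw [← finrank_add_finrank_rSpace_inf_orthogonal
    (sup_le (sup_le (rUp_le_rSpace i 1) (hmap r₁ s₁)) (hmap r₂ s₂))]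
  rw [rUp_zero_eq, map_AdLin_rSpace_inf_orthogonal, map_AdLin_rSpace_inf_orthogonal, hsup, hsup,
    ← inf_inf_distrib_left, ← inf_inf_distrib_left]

section ParameterMatrix

variable {R : Type*} [CommRing R]

/-- The last coordinate of the null vector with affine coordinates `(r, s)`; `h` is `1 / 2`. -/
def nullCoord (i : Fin 2) (h r s : R) : R :=
  if i = 0 then r * s else h * (r ^ 2 + s ^ 2)

/-- The linear conditions on the coordinates of `rUp i 0` cut out by the translate of `rUp i 0`
with parameters `(r, s)`, where `p` is the associated `nullCoord`. -/
def translateRow (i : Fin 2) (p r s : R) : Fin 3 → Fin 6 → R :=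
  if i = 0 then
    ![![-2 * r, -r ^ 2, -2 * p, -(r * p), s, 0],
      ![-2 * s, -2 * p, -s ^ 2, -(s * p), 0, r],
      ![4 * p, 2 * r * p, 2 * s * p, p ^ 2, -s ^ 2, -r ^ 2]]
  else
    ![![-2 * r, -(r ^ 2 + p), -(r * s), -(r * p), r, s],
      ![-2 * s, -(r * s), -(s ^ 2 + p), -(s * p), -s, r],
      ![4 * p, 2 * r * p, 2 * s * p, p ^ 2, s ^ 2 - r ^ 2, -2 * r * s]]

/-- The conditions cut out by two translates of `rUp i 0`. -/
def paramMatrix (i : Fin 2) (h r₁ s₁ r₂ s₂ : R) : Matrix (Fin 6) (Fin 6) R :=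
  let A := translateRow i (nullCoord i h r₁ s₁) r₁ s₁
  let B := translateRow i (nullCoord i h r₂ s₂) r₂ s₂
  Matrix.of ![A 0, A 1, A 2, B 0, B 1, B 2]

/-- The coordinates of (four times) the square of the linear form with coefficients `a, b, c`
in `nullCoord i h r s, r, s`. -/
def squareCoord (i : Fin 2) (a b c : R) : Fin 6 → R :=
  if i = 0 then ![2 * b * c, 4 * a * b, 4 * a * c, 4 * a ^ 2, -4 * c ^ 2, -4 * b ^ 2]
  else ![b ^ 2 + c ^ 2, 4 * a * b, 4 * a * c, 4 * a ^ 2, 2 * (c ^ 2 - b ^ 2), -4 * b * c]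

theorem translateRow_dotProduct_squareCoord {i : Fin 2} {h r s a b c : R} (h2 : 2 * h = 1)
    (habc : a * nullCoord i h r s + b * r + c * s = 0) (k : Fin 3) :
    translateRow i (nullCoord i h r s) r s k ⬝ᵥ squareCoord i a b c = 0 := by
  fin_cases i
  · simp only [nullCoord, Fin.zero_eta, if_true] at habc ⊢
    fin_cases k <;>
      simp [translateRow, squareCoord, dotProduct, Fin.sum_univ_succ] <;> grind
  · simp only [nullCoord, Fin.mk_one, one_ne_zero, if_false] at habc ⊢
    have hp : r ^ 2 + s ^ 2 = 2 * (h * (r ^ 2 + s ^ 2)) := by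
      linear_combination -(r ^ 2 + s ^ 2) * h2
    generalize h * (r ^ 2 + s ^ 2) = p at hp habc ⊢
    fin_cases k <;>
      simp [translateRow, squareCoord, dotProduct, Fin.sum_univ_succ] <;> grind

theorem map_paramMatrix {S : Type*} [CommRing S] (f : R →+* S) (i : Fin 2) (h r₁ s₁ r₂ s₂ : R) :
    f.mapMatrix (paramMatrix i h r₁ s₁ r₂ s₂) =
      paramMatrix i (f h) (f r₁) (f s₁) (f r₂) (f s₂) := by
  fin_cases i <;> ext a b <;> fin_cases a <;> fin_cases b <;>
    simp [paramMatrix, translateRow, nullCoord, map_ofNat]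

theorem paramMatrix_mulVec_squareCoord (i : Fin 2) {h : R} (h2 : 2 * h = 1) (r₁ s₁ r₂ s₂ : R) :
    paramMatrix i h r₁ s₁ r₂ s₂ *ᵥ
      squareCoord i (r₁ * s₂ - s₁ * r₂)
        (s₁ * nullCoord i h r₂ s₂ - nullCoord i h r₁ s₁ * s₂)
        (nullCoord i h r₁ s₁ * r₂ - r₁ * nullCoord i h r₂ s₂) = 0 := by
  ext k
  fin_cases k <;> exact translateRow_dotProduct_squareCoord h2 (by ring) _

end ParameterMatrix

/-- The parameter matrix over the ring of polynomials in the parameters. -/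
noncomputable def polyMatrix (i : Fin 2) : Matrix (Fin 6) (Fin 6) (MvPolynomial (Fin 4) ℝ) :=
  paramMatrix i (MvPolynomial.C 2⁻¹) (MvPolynomial.X 0) (MvPolynomial.X 1) (MvPolynomial.X 2)
    (MvPolynomial.X 3)

theorem map_eval_polyMatrix (i : Fin 2) (r₁ s₁ r₂ s₂ : ℝ) :
    (MvPolynomial.eval ![r₁, s₁, r₂, s₂]).mapMatrix (polyMatrix i) =
      paramMatrix i 2⁻¹ r₁ s₁ r₂ s₂ := by
  rw [polyMatrix, map_paramMatrix]
  simp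

theorem det_polyMatrix (i : Fin 2) : (polyMatrix i).det = 0 := by
  refine Matrix.exists_mulVec_eq_zero_iff.mp ⟨_, fun h => ?_,
    paramMatrix_mulVec_squareCoord i ?_ _ _ _ _⟩
  · have h0 := congrArg (MvPolynomial.eval ![1, 1, -1, -1]) (congrFun h 0)
    fin_cases i <;> simp [squareCoord, nullCoord] at h0 <;> norm_num at h0
  · rw [← map_ofNat MvPolynomial.C, ← map_mul]
    simp

theorem det_paramMatrix (i : Fin 2) (r₁ s₁ r₂ s₂ : ℝ) :
    (paramMatrix i 2⁻¹ r₁ s₁ r₂ s₂).det = 0 := by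
  rw [← map_eval_polyMatrix, ← RingHom.map_det, det_polyMatrix, map_zero]

/-- The sum of the squares of the cofactors of `polyMatrix i`. -/
noncomputable def genericPoly (i : Fin 2) : MvPolynomial (Fin 4) ℝ :=
  ∑ a, ∑ b, (polyMatrix i).adjugate a b ^ 2

theorem eval_genericPoly_ne_zero_iff (i : Fin 2) (r₁ s₁ r₂ s₂ : ℝ) :
    MvPolynomial.eval ![r₁, s₁, r₂, s₂] (genericPoly i) ≠ 0 ↔
      (paramMatrix i 2⁻¹ r₁ s₁ r₂ s₂).adjugate ≠ 0 := by
  rw [← map_eval_polyMatrix, ← RingHom.map_adjugate, genericPoly, not_iff_not, ← Matrix.ext_iff]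
  generalize (polyMatrix i).adjugate = A
  simp only [map_sum, map_pow, RingHom.mapMatrix_apply, Matrix.map_apply, Matrix.zero_apply]
  rw [Finset.sum_eq_zero_iff_of_nonneg fun a _ => Finset.sum_nonneg fun b _ => sq_nonneg _]
  refine ⟨fun h a b => ?_, fun h a _ => Finset.sum_eq_zero fun b _ => ?_⟩
  · have hab := h a (Finset.mem_univ a)
    rw [Finset.sum_eq_zero_iff_of_nonneg fun b _ => sq_nonneg _] at hab
    exact pow_eq_zero_iff two_ne_zero |>.mp (hab b (Finset.mem_univ b))
  · exact pow_eq_zero_iff two_ne_zero |>.mpr (h a b)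

/-- The coordinates on `rUp i 0`. -/
def upCoord (i : Fin 2) : (Fin 6 → ℝ) →ₗ[ℝ] M4 :=
  rCoord i ∘ₗ
    { toFun := fun c => ![c 0, c 1, c 2, c 3, c 4, c 5, 0, 0, 0]
      map_add' := fun x y => by ext k; fin_cases k <;> simp
      map_smul' := fun t x => by ext k; fin_cases k <;> simp }

theorem upCoord_apply (i : Fin 2) (c : Fin 6 → ℝ) :
    upCoord i c = rCoord i ![c 0, c 1, c 2, c 3, c 4, c 5, 0, 0, 0] := rfl

theorem upCoord_injective (i : Fin 2) : Function.Injective (upCoord i) := by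
  intro x y h
  rw [upCoord_apply, upCoord_apply] at h
  have h' := fun k => congrFun (rCoord_injective i h) k
  ext k
  fin_cases k
  exacts [h' 0, h' 1, h' 2, h' 3, h' 4, h' 5]

theorem AdLin_upCoord_mem_rUp_zero_iff (i : Fin 2) (c : Fin 6 → ℝ) (r s : ℝ) :
    AdLin ((uMat i r s)ᵀ)⁻¹ (upCoord i c) ∈ rUp i 0 ↔
      ∀ k, translateRow i (nullCoord i 2⁻¹ r s) r s k ⬝ᵥ c = 0 := by
  have hr : AdLin ((uMat i r s)ᵀ)⁻¹ (upCoord i c) ∈ rSpace i := by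
    rw [inv_transpose_uMat, upCoord_apply]
    exact AdLin_transpose_uMat_mem_rSpace _ _ (rCoord_mem_rSpace i _)
  have hentry : AdLin ((uMat i r s)ᵀ)⁻¹ (upCoord i c) =
      (uMat i (-r) (-s))ᵀ * (rCoord i ![c 0, c 1, c 2, c 3, c 4, c 5, 0, 0, 0] *
        (uMat i r s)ᵀ) := by
    rw [← upCoord_apply, ← inv_transpose_uMat, ← Matrix.mul_assoc]
    change _ * _ * (((uMat i r s)ᵀ)⁻¹)⁻¹ = _
    rw [Matrix.nonsing_inv_nonsing_inv _ (isUnit_det_transpose_uMat i r s)]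
  rw [mem_rUp_zero_iff, and_iff_right hr, Fin.forall_fin_succ, Fin.forall_fin_succ,
    Fin.forall_fin_one, hentry]
  refine and_congr (Eq.congr_left ?_) (and_congr (Eq.congr_left ?_) (Eq.congr_left ?_)) <;>
    fin_cases i <;>
    simp [Matrix.mul_apply, Fin.sum_univ_succ, uMat, rCoord, translateRow, nullCoord,
      dotProduct, Matrix.vecMul] <;> ring

theorem inf_eq_map_upCoord (i : Fin 2) (r₁ s₁ r₂ s₂ : ℝ) :
    rUp i 0 ⊓ Submodule.map (AdLin (uMat i r₁ s₁)ᵀ) (rUp i 0) ⊓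
        Submodule.map (AdLin (uMat i r₂ s₂)ᵀ) (rUp i 0) =
      (LinearMap.ker (paramMatrix i 2⁻¹ r₁ s₁ r₂ s₂).mulVecLin).map (upCoord i) := by
  have hker : ∀ c : Fin 6 → ℝ, c ∈ LinearMap.ker (paramMatrix i 2⁻¹ r₁ s₁ r₂ s₂).mulVecLin ↔
      (∀ k, translateRow i (nullCoord i 2⁻¹ r₁ s₁) r₁ s₁ k ⬝ᵥ c = 0) ∧
        ∀ k, translateRow i (nullCoord i 2⁻¹ r₂ s₂) r₂ s₂ k ⬝ᵥ c = 0 := by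
    intro c
    rw [LinearMap.mem_ker, Matrix.mulVecLin_apply, funext_iff]
    constructor
    · intro h
      constructor <;> intro k <;> fin_cases k
      exacts [h 0, h 1, h 2, h 3, h 4, h 5]
    · rintro ⟨h1, h2⟩ k
      fin_cases k
      exacts [h1 0, h1 1, h1 2, h2 0, h2 1, h2 2]
  ext X
  rw [Submodule.mem_inf, Submodule.mem_inf, mem_map_AdLin_iff (isUnit_det_transpose_uMat i r₁ s₁),
    mem_map_AdLin_iff (isUnit_det_transpose_uMat i r₂ s₂)]
  constructor
  · rintro ⟨⟨h0, h1⟩, h2⟩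
    obtain ⟨d, hd, rfl⟩ := mem_rUp_iff.mp h0
    have hX : upCoord i ![d 0, d 1, d 2, d 3, d 4, d 5] = rCoord i d := by
      rw [upCoord_apply]
      congr 1
      ext k
      fin_cases k
      exacts [rfl, rfl, rfl, rfl, rfl, rfl, (hd 6 (by decide)).symm, (hd 7 (by decide)).symm,
        (hd 8 (by decide)).symm]
    rw [← hX] at h1 h2 ⊢
    exact Submodule.mem_map_of_mem ((hker _).mpr
      ⟨(AdLin_upCoord_mem_rUp_zero_iff i _ r₁ s₁).mp h1,
        (AdLin_upCoord_mem_rUp_zero_iff i _ r₂ s₂).mp h2⟩)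
  · rintro ⟨c, hc, rfl⟩
    obtain ⟨h1, h2⟩ := (hker c).mp hc
    refine ⟨⟨?_, (AdLin_upCoord_mem_rUp_zero_iff i c r₁ s₁).mpr h1⟩,
      (AdLin_upCoord_mem_rUp_zero_iff i c r₂ s₂).mpr h2⟩
    rw [upCoord_apply]
    refine mem_rUp_iff.mpr ⟨_, fun k hk => ?_, rfl⟩
    fin_cases k <;> simp [rWeight] at hk ⊢

theorem finrank_inf_eq_one_iff (i : Fin 2) (r₁ s₁ r₂ s₂ : ℝ) :
    Module.finrank ℝ
        ↥(rUp i 0 ⊓ Submodule.map (AdLin (uMat i r₁ s₁)ᵀ) (rUp i 0) ⊓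
          Submodule.map (AdLin (uMat i r₂ s₂)ᵀ) (rUp i 0)) = 1 ↔
      MvPolynomial.eval ![r₁, s₁, r₂, s₂] (genericPoly i) ≠ 0 := by
  rw [inf_eq_map_upCoord,
    ← (Submodule.equivMapOfInjective _ (upCoord_injective i) _).finrank_eq,
    finrank_ker_mulVecLin_eq_one_iff (det_paramMatrix i r₁ s₁ r₂ s₂),
    eval_genericPoly_ne_zero_iff]

theorem genericPoly_ne_zero (i : Fin 2) : genericPoly i ≠ 0 := by
  have hadj : (paramMatrix i (2⁻¹ : ℝ) 1 1 (-1) (-1)).adjugate ≠ 0 := by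
    rw [← finrank_ker_mulVecLin_eq_one_iff (det_paramMatrix i _ _ _ _)]
    refine finrank_eq_one_iff'.mpr ?_
    let v : Fin 6 → ℝ := if i = 0 then ![1, 0, 0, 0, 2, 2] else ![1, 0, 0, 0, 0, 2]
    have hv : paramMatrix i (2⁻¹ : ℝ) 1 1 (-1) (-1) *ᵥ v = 0 := by
      ext k
      fin_cases i <;> fin_cases k <;>
        simp [v, Matrix.mulVec, paramMatrix, translateRow, nullCoord, dotProduct,
          Fin.sum_univ_succ] <;> norm_num
    refine ⟨⟨v, by simpa using hv⟩, fun h => ?_, ?_⟩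
    · have h0 := congrFun (congrArg Subtype.val h) 0
      fin_cases i <;> simp [v] at h0
    · rintro ⟨w, hw⟩
      refine ⟨w 0, Subtype.ext ?_⟩
      change w 0 • v = w
      have hw' : ∀ k, (paramMatrix i (2⁻¹ : ℝ) 1 1 (-1) (-1) *ᵥ w) k = 0 :=
        fun k => congrFun (show _ = (0 : Fin 6 → ℝ) from by simpa using hw) k
      have e0 := hw' 0
      have e1 := hw' 1
      have e2 := hw' 2
      have e3 := hw' 3
      have e4 := hw' 4
      have e5 := hw' 5
      clear hw hw'
      fin_cases i <;>
        simp [Matrix.mulVec, paramMatrix, translateRow, nullCoord, dotProduct,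
          Fin.sum_univ_succ] at e0 e1 e2 e3 e4 e5 <;>
        ext k <;> fin_cases k <;> simp [v] <;> linarith
  intro h
  have := (eval_genericPoly_ne_zero_iff i 1 1 (-1) (-1)).mpr hadj
  rw [h] at this
  simp at this

/-- generic position of three copies: polynomials R₁, R₂. -/
theorem stmt11 (i : Fin 2) :
    ∃ R₁ R₂ : MvPolynomial (Fin 4) ℝ, R₁ ≠ 0 ∧ R₂ ≠ 0 ∧
    (∀ r₁ s₁ r₂ s₂ : ℝ,
      (Module.finrank ℝ
          ↥(rUp i 1 ⊔ Submodule.map (AdLin (uMat i r₁ s₁)ᵀ) (rUp i 1) ⊔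
            Submodule.map (AdLin (uMat i r₂ s₂)ᵀ) (rUp i 1)) = 8 ↔
        MvPolynomial.eval ![r₁, s₁, r₂, s₂] R₁ ≠ 0)) ∧
    (∀ r₁ s₁ r₂ s₂ : ℝ,
      (Module.finrank ℝ
          ↥(rUp i 0 ⊓ Submodule.map (AdLin (uMat i r₁ s₁)ᵀ) (rUp i 0) ⊓
            Submodule.map (AdLin (uMat i r₂ s₂)ᵀ) (rUp i 0)) = 1 ↔
        MvPolynomial.eval ![r₁, s₁, r₂, s₂] R₂ ≠ 0)) := by
  refine ⟨genericPoly i, genericPoly i, genericPoly_ne_zero i, genericPoly_ne_zero i,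
    fun r₁ s₁ r₂ s₂ => ?_, fun r₁ s₁ r₂ s₂ => finrank_inf_eq_one_iff i r₁ s₁ r₂ s₂⟩
  rw [← finrank_inf_eq_one_iff]
  have := finrank_sup_add_finrank_inf i r₁ s₁ r₂ s₂
  omega
end

section
/- Fix i ∈ {1,2}. There exists a constant c > 0 such that for all v, w ∈ 𝔯ᵢ with ‖v‖₂ = ‖w‖₂ = 1 (where ‖X‖₂ = √tr(XXᵀ)), one has sup over (r,s) ∈ [−1,1]² of |⟨v, Ad(u^{(i)}_{r,s}) w⟩| ≥ c·‖π^{(2)}(v)‖₂⁹, where π^{(2)} is the orthogonal projection of 𝔯ᵢ onto the highest weight line 𝔯ᵢ^{(2)} = (𝔯ᵢ)₂. -/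
open Matrix MeasureTheory
open scoped Classical

theorem abs_le_of_mul_abs_le {a x t D D' : ℝ} (ht : 0 < t) (ha : |a| = t) (hD : t * D' = D)
    (h : |x * a| ≤ D) : |x| ≤ D' := by
  rw [abs_mul, ha, ← hD, mul_comm] at h
  exact le_of_mul_le_mul_left h ht

theorem abs_mul_le_of_abs_le_one {x a D : ℝ} (ha : |a| ≤ 1) (h : |x| ≤ D) : |x * a| ≤ D := by
  rw [abs_mul]
  nlinarith [abs_nonneg x, abs_nonneg a]

/-- The general element of `rSpace 0`. -/
def rMatSplit (a b c d e f g h k : ℝ) : M4 :=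
  !![d, b, c, a; g, -d, e, -c; h, f, -d, -b; k, -h, -g, d]

/-- The general element of `rSpace 1`. -/
def rMatHyp (a b c d e f g h k : ℝ) : M4 :=
  !![d, b, c, a; g, -d + e, f, -b; h, f, -d - e, -c; k, -g, -h, d]

theorem mul_Qmat_of_mem_rSpace {i : Fin 2} {X : M4} (hX : X ∈ rSpace i) :
    X * Qmat i = Qmat i * Xᵀ := by
  have hdet : IsUnit (Qmat i).det := by
    rw [isUnit_iff_ne_zero]
    fin_cases i <;> simp [Qmat, Matrix.det_succ_row_zero, Fin.sum_univ_succ, Fin.succAbove]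
  have h : -(Qmat i * Xᵀ * (Qmat i)⁻¹) + X = 0 := hX.2
  have h' : X = Qmat i * Xᵀ * (Qmat i)⁻¹ := by
    rw [neg_add_eq_zero] at h
    exact h.symm
  conv_lhs => rw [h']
  rw [Matrix.mul_assoc, Matrix.nonsing_inv_mul _ hdet, Matrix.mul_one]

theorem eq_rMatSplit {X : M4} (hX : X ∈ rSpace 0) :
    X = rMatSplit (X 0 3) (X 0 1) (X 0 2) (X 0 0) (X 1 2) (X 2 1) (X 1 0) (X 2 0) (X 3 0) := by
  have hQ := mul_Qmat_of_mem_rSpace hX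
  have htr : X.trace = 0 := hX.1
  have h01 := congrFun (congrFun hQ 0) 1
  have h02 := congrFun (congrFun hQ 0) 2
  have h03 := congrFun (congrFun hQ 0) 3
  have h12 := congrFun (congrFun hQ 1) 2
  have h13 := congrFun (congrFun hQ 1) 3
  have h23 := congrFun (congrFun hQ 2) 3
  simp [Qmat, Matrix.mul_apply, Fin.sum_univ_four] at h01 h02 h03 h12 h13 h23
  simp [Matrix.trace, Fin.sum_univ_four] at htr
  ext p q
  fin_cases p <;> fin_cases q <;> simp [rMatSplit] <;> linarith

theorem eq_rMatHyp {X : M4} (hX : X ∈ rSpace 1) :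
    X = rMatHyp (X 0 3) (X 0 1) (X 0 2) (X 0 0) ((X 1 1 - X 2 2) / 2) (X 1 2)
      (X 1 0) (X 2 0) (X 3 0) := by
  have hQ := mul_Qmat_of_mem_rSpace hX
  have htr : X.trace = 0 := hX.1
  have h01 := congrFun (congrFun hQ 0) 1
  have h02 := congrFun (congrFun hQ 0) 2
  have h03 := congrFun (congrFun hQ 0) 3
  have h12 := congrFun (congrFun hQ 1) 2
  have h13 := congrFun (congrFun hQ 1) 3
  have h23 := congrFun (congrFun hQ 2) 3
  simp [Qmat, Matrix.mul_apply, Fin.sum_univ_four] at h01 h02 h03 h12 h13 h23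
  simp [Matrix.trace, Fin.sum_univ_four] at htr
  ext p q
  fin_cases p <;> fin_cases q <;> simp [rMatHyp] <;> linarith

theorem uMat_inv (i : Fin 2) (r s : ℝ) : (uMat i r s)⁻¹ = uMat i (-r) (-s) := by
  apply Matrix.inv_eq_right_inv
  ext p q
  fin_cases i <;> fin_cases p <;> fin_cases q <;>
    simp [uMat, Matrix.mul_apply, Fin.sum_univ_four] <;> ring

theorem tinner_eq_sum (X Y : M4) : tinner X Y = ∑ p, ∑ q, X p q * Y p q := by
  simp [tinner, Matrix.trace, Matrix.mul_apply]

theorem tinner_Adm_rMatSplit (va vb vc vd ve vf vg vh vk wa wb wc wd we wf wg wh wk r s : ℝ) :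
    tinner (rMatSplit va vb vc vd ve vf vg vh vk)
      (Adm (uMat 0 r s) (rMatSplit wa wb wc wd we wf wg wh wk)) =
    wk*va * (r^2*s^2) + (2*(wg*va) - 2*(wk*vb)) * (r^2*s) + (2*(wh*va) - 2*(wk*vc)) * (r*s^2)
      + (4*(wd*va) - 4*(wg*vc) - 4*(wh*vb) + 4*(wk*vd)) * (r*s)
      + (-(we*va) - 2*(wg*vb) - wk*vf) * r^2 + (-(wf*va) - 2*(wh*vc) - wk*ve) * s^2
      + (-2*(wc*va) - 4*(wd*vb) + 2*(we*vc) + 4*(wg*vd) - 2*(wh*vf) + 2*(wk*vh)) * r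
      + (-2*(wb*va) - 4*(wd*vc) + 2*(wf*vb) - 2*(wg*ve) + 4*(wh*vd) + 2*(wk*vg)) * s
      + (wa*va + 2*(wb*vb) + 2*(wc*vc) + 4*(wd*vd) + we*ve + wf*vf + 2*(wg*vg) + 2*(wh*vh)
        + wk*vk) := by
  rw [tinner_eq_sum, Adm, uMat_inv]
  simp only [Matrix.mul_apply, Fin.sum_univ_four]
  simp [uMat, rMatSplit]
  ring

theorem tinner_Adm_rMatHyp (va vb vc vd ve vf vg vh vk wa wb wc wd we wf wg wh wk r s : ℝ) :
    tinner (rMatHyp va vb vc vd ve vf vg vh vk)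
      (Adm (uMat 1 r s) (rMatHyp wa wb wc wd we wf wg wh wk)) =
    wk*va / 4 * (r^2 + s^2)^2 + (wg*va - wk*vb) * (r * (r^2 + s^2))
      + (wh*va - wk*vc) * (s * (r^2 + s^2))
      + (2*(wd*va) - we*va - 3*(wg*vb) - wh*vc + 2*(wk*vd) - wk*ve) * r^2
      + (2*(wd*va) + we*va - wg*vb - 3*(wh*vc) + 2*(wk*vd) + wk*ve) * s^2
      + (-2*(wf*va) - 2*(wg*vc) - 2*(wh*vb) - 2*(wk*vf)) * (r*s)
      + (-2*(wb*va) - 4*(wd*vb) + 2*(we*vb) + 2*(wf*vc) + 4*(wg*vd) - 2*(wg*ve) - 2*(wh*vf)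
        + 2*(wk*vg)) * r
      + (-2*(wc*va) - 4*(wd*vc) - 2*(we*vc) + 2*(wf*vb) - 2*(wg*vf) + 4*(wh*vd) + 2*(wh*ve)
        + 2*(wk*vh)) * s
      + (wa*va + 2*(wb*vb) + 2*(wc*vc) + 4*(wd*vd) + 2*(we*ve) + 2*(wf*vf) + 2*(wg*vg)
        + 2*(wh*vh) + wk*vk) := by
  rw [tinner_eq_sum, Adm, uMat_inv]
  simp only [Matrix.mul_apply, Fin.sum_univ_four]
  simp [uMat, rMatHyp]
  ring

/-- Coefficients of a polynomial of bidegree at most `(2, 2)` are controlled by its values on the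
unit square. -/
theorem coeff_bound_split {p q₁ q₂ m d₁ d₂ l₁ l₂ n M : ℝ}
    (hM : ∀ r s : ℝ, |r| ≤ 1 → |s| ≤ 1 → |p * (r^2*s^2) + q₁ * (r^2*s) + q₂ * (r*s^2) + m * (r*s)
      + d₁ * r^2 + d₂ * s^2 + l₁ * r + l₂ * s + n| ≤ M) :
    |p| ≤ 4 * M ∧ |q₁| ≤ 2 * M ∧ |q₂| ≤ 2 * M ∧ |m| ≤ M ∧ |d₁| ≤ 2 * M ∧ |d₂| ≤ 2 * M ∧
      |l₁| ≤ M ∧ |l₂| ≤ M ∧ |n| ≤ M := by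
  have h1 := hM 0 0 (by norm_num) (by norm_num)
  have h2 := hM 0 1 (by norm_num) (by norm_num)
  have h3 := hM 0 (-1) (by norm_num) (by norm_num)
  have h4 := hM 1 0 (by norm_num) (by norm_num)
  have h5 := hM 1 1 (by norm_num) (by norm_num)
  have h6 := hM 1 (-1) (by norm_num) (by norm_num)
  have h7 := hM (-1) 0 (by norm_num) (by norm_num)
  have h8 := hM (-1) 1 (by norm_num) (by norm_num)
  have h9 := hM (-1) (-1) (by norm_num) (by norm_num)
  simp only [abs_le] at *
  refine ⟨⟨?_, ?_⟩, ⟨?_, ?_⟩, ⟨?_, ?_⟩, ⟨?_, ?_⟩, ⟨?_, ?_⟩, ⟨?_, ?_⟩, ⟨?_, ?_⟩, ⟨?_, ?_⟩, ?_, ?_⟩ <;>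
    linarith

theorem coeff_bound_hyp {p q₁ q₂ m d₁ d₂ l₁ l₂ n M : ℝ}
    (hM : ∀ r s : ℝ, |r| ≤ 1 → |s| ≤ 1 → |p * (r^2 + s^2)^2 + q₁ * (r * (r^2 + s^2))
      + q₂ * (s * (r^2 + s^2)) + d₁ * r^2 + d₂ * s^2 + m * (r*s) + l₁ * r + l₂ * s + n| ≤ M) :
    |p| ≤ 14 * M ∧ |q₁| ≤ 4 * M ∧ |q₂| ≤ 4 * M ∧ |m| ≤ M ∧ |d₁| ≤ 16 * M ∧ |d₂| ≤ 16 * M ∧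
      |l₁| ≤ 5 * M ∧ |l₂| ≤ 5 * M ∧ |n| ≤ M := by
  have h1 := hM 0 0 (by norm_num) (by norm_num)
  have h2 := hM 0 1 (by norm_num) (by norm_num)
  have h3 := hM 0 (-1) (by norm_num) (by norm_num)
  have h4 := hM 1 0 (by norm_num) (by norm_num)
  have h5 := hM (-1) 0 (by norm_num) (by norm_num)
  have h6 := hM 1 1 (by norm_num) (by norm_num)
  have h7 := hM 1 (-1) (by norm_num) (by norm_num)
  have h8 := hM (-1) 1 (by norm_num) (by norm_num)
  have h9 := hM (-1) (-1) (by norm_num) (by norm_num)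
  have h10 := hM (1/2) 0 (by norm_num [abs_le]) (by norm_num)
  have h11 := hM (-1/2) 0 (by norm_num [abs_le]) (by norm_num)
  have h12 := hM 0 (1/2) (by norm_num) (by norm_num [abs_le])
  have h13 := hM 0 (-1/2) (by norm_num) (by norm_num [abs_le])
  simp only [abs_le] at *
  refine ⟨⟨?_, ?_⟩, ⟨?_, ?_⟩, ⟨?_, ?_⟩, ⟨?_, ?_⟩, ⟨?_, ?_⟩, ⟨?_, ?_⟩, ⟨?_, ?_⟩, ⟨?_, ?_⟩, ?_, ?_⟩ <;>
    linarith

theorem abs_apply_le_of_mnorm2_eq_one {v : M4} (hv : mnorm2 v = 1) (p q : Fin 4) :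
    |v p q| ≤ 1 := by
  rw [mnorm2, Real.sqrt_eq_one, tinner_eq_sum] at hv
  rw [← sq_le_one_iff_abs_le_one, ← hv, sq]
  calc v p q * v p q ≤ ∑ q', v p q' * v p q' :=
        Finset.single_le_sum (f := fun q' => v p q' * v p q')
          (fun _ _ => mul_self_nonneg _) (Finset.mem_univ q)
    _ ≤ ∑ p', ∑ q', v p' q' * v p' q' :=
        Finset.single_le_sum (f := fun p' => ∑ q', v p' q' * v p' q')
          (fun _ _ => Finset.sum_nonneg fun _ _ => mul_self_nonneg _) (Finset.mem_univ p)

theorem one_le_of_abs_apply_le {w : M4} (hw : mnorm2 w = 1) {B : ℝ}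
    (h : ∀ p q, |w p q| ≤ B) : 1 ≤ 4 * B := by
  have hB : 0 ≤ B := (abs_nonneg _).trans (h 0 0)
  rw [mnorm2, Real.sqrt_eq_one, tinner_eq_sum] at hw
  have : (1 : ℝ) ≤ ∑ _p : Fin 4, ∑ _q : Fin 4, B ^ 2 := by
    rw [← hw]
    refine Finset.sum_le_sum fun p _ => Finset.sum_le_sum fun q _ => ?_
    rw [← sq]
    exact sq_le_sq' (abs_le.1 (h p q)).1 (abs_le.1 (h p q)).2
  simp at this
  nlinarith

theorem apply_eq_zero_of_mem_rUp_two {i : Fin 2} {X : M4} (hX : X ∈ rUp i 2) (p q : Fin 4)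
    (hpq : (p, q) ≠ (0, 3)) : X p q = 0 := by
  let W : Submodule ℝ M4 := LinearMap.ker (Matrix.entryLinearMap ℝ ℝ p q)
  suffices h : rUp i 2 ≤ W from h hX
  refine iSup₂_le fun μ hμ Y hY => ?_
  have hμ' : (2 : ℝ) ≤ μ := by exact_mod_cast hμ
  have hY' : adA Y - (μ : ℝ) • Y = 0 := hY.2
  have h := congrFun (congrFun hY' p) q
  change Y p q = 0
  have key : (![1, 0, 0, -1] p - ![1, 0, 0, -1] q - (μ : ℝ)) * Y p q = 0 := by
    simp [adA, aWt, Matrix.diagonal_mul, Matrix.mul_diagonal] at h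
    linarith
  refine (mul_eq_zero.1 key).resolve_left ?_
  fin_cases p <;> fin_cases q <;> simp at hpq ⊢ <;> intro h0 <;> linarith

theorem mnorm2_le_of_mem_rUp_two {i : Fin 2} {X Y : M4} (hY : Y ∈ rUp i 2)
    (h : tinner (X - Y) Y = 0) : mnorm2 Y ≤ |X 0 3| := by
  have h0 := apply_eq_zero_of_mem_rUp_two hY
  have hinner : ∀ Z : M4, tinner Z Y = Z 0 3 * Y 0 3 := by
    intro Z
    rw [tinner_eq_sum, Fintype.sum_eq_single 0, Fintype.sum_eq_single 3]
    · intro q hq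
      rw [h0 0 q (by simpa using hq), mul_zero]
    · intro p hp
      exact Finset.sum_eq_zero fun q _ => by rw [h0 p q (by simp [hp]), mul_zero]
  rw [hinner, Matrix.sub_apply] at h
  rw [mnorm2, hinner, ← sq, Real.sqrt_sq_eq_abs]
  rcases mul_eq_zero.1 h with h | h
  · rw [sub_eq_zero.1 h]
  · simp [h]

theorem bddAbove_matrixCoeff (i : Fin 2) (v w : M4) :
    BddAbove ((fun p : ℝ × ℝ => |tinner v (Adm (uMat i p.1 p.2) w)|) '' uSq) := by
  have hc : Continuous fun p : ℝ × ℝ => uMat i p.1 p.2 := by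
    refine continuous_matrix fun a b => ?_
    fin_cases i <;> fin_cases a <;> fin_cases b <;> simp [uMat] <;> fun_prop
  have hc' : Continuous fun p : ℝ × ℝ => uMat i (-p.1) (-p.2) :=
    hc.comp (f := fun p : ℝ × ℝ => (-p.1, -p.2)) (by fun_prop)
  refine ((isCompact_Icc.prod isCompact_Icc).image ?_).bddAbove
  simp only [Adm, uMat_inv, tinner]
  fun_prop

set_option maxHeartbeats 2000000 in
/-- Back substitution along the weights bounds `w` by the supremum of its matrix coefficients
against `v`, up to five powers of the highest weight coordinate of `v`. -/
theorem abs_apply_le_split {v w : M4} (hv : v ∈ rSpace 0) (hw : w ∈ rSpace 0)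
    (hv1 : mnorm2 v = 1) {M : ℝ} (hv03 : v 0 3 ≠ 0)
    (hM : ∀ r s : ℝ, |r| ≤ 1 → |s| ≤ 1 → |tinner v (Adm (uMat 0 r s) w)| ≤ M) (p q : Fin 4) :
    |w p q| ≤ 6000 * (M / |v 0 3| ^ 5) := by
  have hent := abs_apply_le_of_mnorm2_eq_one hv1
  have ha := hent 0 3
  have hb := hent 0 1
  have hc := hent 0 2
  have hd := hent 0 0
  have he := hent 1 2
  have hf := hent 2 1
  have hg := hent 1 0
  have hh := hent 2 0
  have hk := hent 3 0
  rw [eq_rMatSplit hv, eq_rMatSplit hw] at hM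
  rw [eq_rMatSplit hw]
  simp only [tinner_Adm_rMatSplit] at hM
  generalize v 0 3 = va at *
  generalize v 0 1 = vb at *
  generalize v 0 2 = vc at *
  generalize v 0 0 = vd at *
  generalize v 1 2 = ve at *
  generalize v 2 1 = vf at *
  generalize v 1 0 = vg at *
  generalize v 2 0 = vh at *
  generalize v 3 0 = vk at *
  generalize w 0 3 = wa at *
  generalize w 0 1 = wb at *
  generalize w 0 2 = wc at *
  generalize w 0 0 = wd at *
  generalize w 1 2 = we at *
  generalize w 2 1 = wf at *
  generalize w 1 0 = wg at *
  generalize w 2 0 = wh at *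
  generalize w 3 0 = wk at *
  obtain ⟨c22, c21, c12, c11, c20, c02, c10, c01, c00⟩ := coeff_bound_split hM
  have hM0 : 0 ≤ M := (abs_nonneg _).trans c00
  have ht : 0 < |va| := abs_pos.2 hv03
  obtain ⟨t, hta⟩ : ∃ t, |va| = t := ⟨_, rfl⟩
  rw [hta] at ha ht ⊢
  have hle (n : ℕ) : M / t ^ n ≤ M / t ^ (n + 1) :=
    div_le_div_of_nonneg_left hM0 (by positivity) (pow_le_pow_of_le_one ht.le ha n.le_succ)
  have hmul (K : ℝ) (n : ℕ) : t * (K * (M / t ^ (n + 1))) = K * (M / t ^ n) := by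
    rw [pow_succ]
    field_simp
  have m0 := hle 0
  have m1 := hle 1
  have m2 := hle 2
  have m3 := hle 3
  have m4 := hle 4
  have e0 : M / t ^ 0 = M := by simp
  have hD1 : 0 ≤ M / t ^ 1 := by positivity
  norm_num only at m0 m1 m2 m3 m4
  have bk : |wk| ≤ 4 * (M / t ^ 1) :=
    abs_le_of_mul_abs_le ht hta (hmul 4 0) (by rw [e0]; exact c22)
  have B {x a D : ℝ} (ha : |a| ≤ 1) (h : |x| ≤ D) : -D ≤ x * a ∧ x * a ≤ D :=
    abs_le.1 (abs_mul_le_of_abs_le_one ha h)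
  rw [abs_le] at c21 c12 c11 c20 c02 c10 c01 c00
  have kb := B hb bk
  have kc := B hc bk
  have kd := B hd bk
  have ke := B he bk
  have kf := B hf bk
  have kg := B hg bk
  have kh := B hh bk
  have kk := B hk bk
  have bg : |wg| ≤ 5 * (M / t ^ 2) :=
    abs_le_of_mul_abs_le ht hta (hmul 5 1) (abs_le.2 ⟨by linarith, by linarith⟩)
  have bh : |wh| ≤ 5 * (M / t ^ 2) :=
    abs_le_of_mul_abs_le ht hta (hmul 5 1) (abs_le.2 ⟨by linarith, by linarith⟩)
  have gb := B hb bg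
  have gc := B hc bg
  have gd := B hd bg
  have ge := B he bg
  have gg := B hg bg
  have hb' := B hb bh
  have hc' := B hc bh
  have hd' := B hd bh
  have hf' := B hf bh
  have hh' := B hh bh
  have bd : |wd| ≤ 15 * (M / t ^ 3) :=
    abs_le_of_mul_abs_le ht hta (hmul 15 2) (abs_le.2 ⟨by linarith, by linarith⟩)
  have be : |we| ≤ 16 * (M / t ^ 3) :=
    abs_le_of_mul_abs_le ht hta (hmul 16 2) (abs_le.2 ⟨by linarith, by linarith⟩)
  have bf : |wf| ≤ 16 * (M / t ^ 3) :=
    abs_le_of_mul_abs_le ht hta (hmul 16 2) (abs_le.2 ⟨by linarith, by linarith⟩)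
  have db := B hb bd
  have dc := B hc bd
  have dd := B hd bd
  have ec := B hc be
  have ee := B he be
  have fb := B hb bf
  have ff := B hf bf
  have bb : |wb| ≤ 66 * (M / t ^ 4) :=
    abs_le_of_mul_abs_le ht hta (hmul 66 3) (abs_le.2 ⟨by linarith, by linarith⟩)
  have bc : |wc| ≤ 66 * (M / t ^ 4) :=
    abs_le_of_mul_abs_le ht hta (hmul 66 3) (abs_le.2 ⟨by linarith, by linarith⟩)
  have bb' := B hb bb
  have cc' := B hc bc
  have ba : |wa| ≤ 400 * (M / t ^ 5) :=
    abs_le_of_mul_abs_le ht hta (hmul 400 4) (abs_le.2 ⟨by linarith, by linarith⟩)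
  replace ba : |wa| ≤ 6000 * (M / t ^ 5) := by linarith only [ba, m1, m2, m3, m4, hD1]
  replace bb : |wb| ≤ 6000 * (M / t ^ 5) := by linarith only [bb, m1, m2, m3, m4, hD1]
  replace bc : |wc| ≤ 6000 * (M / t ^ 5) := by linarith only [bc, m1, m2, m3, m4, hD1]
  replace bd : |wd| ≤ 6000 * (M / t ^ 5) := by linarith only [bd, m1, m2, m3, m4, hD1]
  replace bf : |wf| ≤ 6000 * (M / t ^ 5) := by linarith only [bf, m1, m2, m3, m4, hD1]
  replace bg : |wg| ≤ 6000 * (M / t ^ 5) := by linarith only [bg, m1, m2, m3, m4, hD1]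
  replace bh : |wh| ≤ 6000 * (M / t ^ 5) := by linarith only [bh, m1, m2, m3, m4, hD1]
  replace bk : |wk| ≤ 6000 * (M / t ^ 5) := by linarith only [bk, m1, m2, m3, m4, hD1]
  replace be : |we| ≤ 6000 * (M / t ^ 5) := by linarith only [be, m1, m2, m3, m4, hD1]
  fin_cases p <;> fin_cases q <;> simp [rMatSplit] <;> assumption

set_option maxHeartbeats 2000000 in
/-- The analogue of `abs_apply_le_split` for the form of signature `(3, 1)`. -/
theorem abs_apply_le_hyp {v w : M4} (hv : v ∈ rSpace 1) (hw : w ∈ rSpace 1)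
    (hv1 : mnorm2 v = 1) {M : ℝ} (hv03 : v 0 3 ≠ 0)
    (hM : ∀ r s : ℝ, |r| ≤ 1 → |s| ≤ 1 → |tinner v (Adm (uMat 1 r s) w)| ≤ M) (p q : Fin 4) :
    |w p q| ≤ 6000 * (M / |v 0 3| ^ 5) := by
  have hent := abs_apply_le_of_mnorm2_eq_one hv1
  have ha := hent 0 3
  have hb := hent 0 1
  have hc := hent 0 2
  have hd := hent 0 0
  have he : |(v 1 1 - v 2 2) / 2| ≤ 1 := by
    have h1 := abs_le.1 (hent 1 1)
    have h2 := abs_le.1 (hent 2 2)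
    exact abs_le.2 ⟨by linarith, by linarith⟩
  have hf := hent 1 2
  have hg := hent 1 0
  have hh := hent 2 0
  have hk := hent 3 0
  rw [eq_rMatHyp hv, eq_rMatHyp hw] at hM
  rw [eq_rMatHyp hw]
  simp only [tinner_Adm_rMatHyp] at hM
  generalize v 0 3 = va at *
  generalize v 0 1 = vb at *
  generalize v 0 2 = vc at *
  generalize v 0 0 = vd at *
  generalize (v 1 1 - v 2 2) / 2 = ve at *
  generalize v 1 2 = vf at *
  generalize v 1 0 = vg at *
  generalize v 2 0 = vh at *
  generalize v 3 0 = vk at *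
  generalize w 0 3 = wa at *
  generalize w 0 1 = wb at *
  generalize w 0 2 = wc at *
  generalize w 0 0 = wd at *
  generalize (w 1 1 - w 2 2) / 2 = we at *
  generalize w 1 2 = wf at *
  generalize w 1 0 = wg at *
  generalize w 2 0 = wh at *
  generalize w 3 0 = wk at *
  obtain ⟨c4, c30, c03, c11, c20, c02, c10, c01, c00⟩ := coeff_bound_hyp hM
  have hM0 : 0 ≤ M := (abs_nonneg _).trans c00
  have ht : 0 < |va| := abs_pos.2 hv03
  obtain ⟨t, hta⟩ : ∃ t, |va| = t := ⟨_, rfl⟩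
  rw [hta] at ha ht ⊢
  have hle (n : ℕ) : M / t ^ n ≤ M / t ^ (n + 1) :=
    div_le_div_of_nonneg_left hM0 (by positivity) (pow_le_pow_of_le_one ht.le ha n.le_succ)
  have hmul (K : ℝ) (n : ℕ) : t * (K * (M / t ^ (n + 1))) = K * (M / t ^ n) := by
    rw [pow_succ]
    field_simp
  have m0 := hle 0
  have m1 := hle 1
  have m2 := hle 2
  have m3 := hle 3
  have m4 := hle 4
  have e0 : M / t ^ 0 = M := by simp
  have hD1 : 0 ≤ M / t ^ 1 := by positivity
  norm_num only at m0 m1 m2 m3 m4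
  rw [abs_le] at c4 c30 c03 c11 c20 c02 c10 c01 c00
  have bk : |wk| ≤ 56 * (M / t ^ 1) :=
    abs_le_of_mul_abs_le ht hta (hmul 56 0) (abs_le.2 ⟨by linarith, by linarith⟩)
  have B {x a D : ℝ} (ha : |a| ≤ 1) (h : |x| ≤ D) : -D ≤ x * a ∧ x * a ≤ D :=
    abs_le.1 (abs_mul_le_of_abs_le_one ha h)
  have kb := B hb bk
  have kc := B hc bk
  have kd := B hd bk
  have ke := B he bk
  have kf := B hf bk
  have kg := B hg bk
  have kh := B hh bk
  have kk := B hk bk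
  have bg : |wg| ≤ 60 * (M / t ^ 2) :=
    abs_le_of_mul_abs_le ht hta (hmul 60 1) (abs_le.2 ⟨by linarith, by linarith⟩)
  have bh : |wh| ≤ 60 * (M / t ^ 2) :=
    abs_le_of_mul_abs_le ht hta (hmul 60 1) (abs_le.2 ⟨by linarith, by linarith⟩)
  have gb := B hb bg
  have gc := B hc bg
  have gd := B hd bg
  have ge := B he bg
  have gf := B hf bg
  have gg := B hg bg
  have hb' := B hb bh
  have hc' := B hc bh
  have hd' := B hd bh
  have he' := B he bh
  have hf' := B hf bh
  have hh' := B hh bh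
  have bd : |wd| ≤ 184 * (M / t ^ 3) :=
    abs_le_of_mul_abs_le ht hta (hmul 184 2) (abs_le.2 ⟨by linarith, by linarith⟩)
  have be : |we| ≤ 192 * (M / t ^ 3) :=
    abs_le_of_mul_abs_le ht hta (hmul 192 2) (abs_le.2 ⟨by linarith, by linarith⟩)
  have bf : |wf| ≤ 177 * (M / t ^ 3) :=
    abs_le_of_mul_abs_le ht hta (hmul 177 2) (abs_le.2 ⟨by linarith, by linarith⟩)
  have db := B hb bd
  have dc := B hc bd
  have dd := B hd bd
  have eb := B hb be
  have ec := B hc be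
  have ee := B he be
  have fb := B hb bf
  have fc := B hc bf
  have ff := B hf bf
  have bb : |wb| ≤ 1036 * (M / t ^ 4) :=
    abs_le_of_mul_abs_le ht hta (hmul 1036 3) (abs_le.2 ⟨by linarith, by linarith⟩)
  have bc : |wc| ≤ 1036 * (M / t ^ 4) :=
    abs_le_of_mul_abs_le ht hta (hmul 1036 3) (abs_le.2 ⟨by linarith, by linarith⟩)
  have bb' := B hb bb
  have cc' := B hc bc
  have ba : |wa| ≤ 6000 * (M / t ^ 5) :=
    abs_le_of_mul_abs_le ht hta (hmul 6000 4) (abs_le.2 ⟨by linarith, by linarith⟩)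
  have bde : |-wd + we| ≤ 376 * (M / t ^ 3) := by
    rw [abs_le] at bd be ⊢
    constructor <;> linarith
  have bde' : |-wd - we| ≤ 376 * (M / t ^ 3) := by
    rw [abs_le] at bd be ⊢
    constructor <;> linarith
  replace ba : |wa| ≤ 6000 * (M / t ^ 5) := by linarith only [ba, m1, m2, m3, m4, hD1]
  replace bb : |wb| ≤ 6000 * (M / t ^ 5) := by linarith only [bb, m1, m2, m3, m4, hD1]
  replace bc : |wc| ≤ 6000 * (M / t ^ 5) := by linarith only [bc, m1, m2, m3, m4, hD1]
  replace bd : |wd| ≤ 6000 * (M / t ^ 5) := by linarith only [bd, m1, m2, m3, m4, hD1]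
  replace bf : |wf| ≤ 6000 * (M / t ^ 5) := by linarith only [bf, m1, m2, m3, m4, hD1]
  replace bg : |wg| ≤ 6000 * (M / t ^ 5) := by linarith only [bg, m1, m2, m3, m4, hD1]
  replace bh : |wh| ≤ 6000 * (M / t ^ 5) := by linarith only [bh, m1, m2, m3, m4, hD1]
  replace bk : |wk| ≤ 6000 * (M / t ^ 5) := by linarith only [bk, m1, m2, m3, m4, hD1]
  replace bde : |-wd + we| ≤ 6000 * (M / t ^ 5) := by linarith only [bde, m1, m2, m3, m4, hD1]
  replace bde' : |-wd - we| ≤ 6000 * (M / t ^ 5) := by linarith only [bde', m1, m2, m3, m4, hD1]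
  fin_cases p <;> fin_cases q <;> simp [rMatHyp] <;> assumption

/-- lower bound for the sup of matrix coefficients over the unipotent ball,
in terms of the highest weight component. -/
theorem stmt13 (i : Fin 2) :
    ∃ c : ℝ, 0 < c ∧
    ∀ v w : M4, v ∈ rSpace i → w ∈ rSpace i → mnorm2 v = 1 → mnorm2 w = 1 →
    ∀ π : M4 → M4,
      (∀ X ∈ rSpace i, π X ∈ rUp i 2 ∧ ∀ Y ∈ rUp i 2, tinner (X - π X) Y = 0) →
      c * (mnorm2 (π v)) ^ (9:ℕ) ≤
        sSup ((fun p : ℝ × ℝ => |tinner v (Adm (uMat i p.1 p.2) w)|) '' uSq) := by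
  refine ⟨1 / 24000, by norm_num, fun v w hv hw hv1 hw1 π hπ => ?_⟩
  set S := sSup ((fun p : ℝ × ℝ => |tinner v (Adm (uMat i p.1 p.2) w)|) '' uSq)
  have hM : ∀ r s : ℝ, |r| ≤ 1 → |s| ≤ 1 → |tinner v (Adm (uMat i r s) w)| ≤ S := by
    intro r s hr hs
    exact le_csSup (bddAbove_matrixCoeff i v w)
      ⟨(r, s), ⟨abs_le.1 hr, abs_le.1 hs⟩, rfl⟩
  have hproj : mnorm2 (π v) ≤ |v 0 3| :=
    mnorm2_le_of_mem_rUp_two (hπ v hv).1 ((hπ v hv).2 _ (hπ v hv).1)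
  have hpow : mnorm2 (π v) ^ 9 ≤ |v 0 3| ^ 5 :=
    (pow_le_pow_left₀ (Real.sqrt_nonneg _) hproj 9).trans
      (pow_le_pow_of_le_one (abs_nonneg _) (abs_apply_le_of_mnorm2_eq_one hv1 0 3) (by norm_num))
  by_cases h03 : v 0 3 = 0
  · have hS0 : 0 ≤ S := (abs_nonneg _).trans (hM 0 0 (by simp) (by simp))
    rw [h03, abs_zero] at hpow
    linarith
  · have hw' : ∀ p q, |w p q| ≤ 6000 * (S / |v 0 3| ^ 5) := by
      clear_value S
      clear hπ
      fin_cases i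
      · exact abs_apply_le_split hv hw hv1 h03 hM
      · exact abs_apply_le_hyp hv hw hv1 h03 hM
    have h1 := one_le_of_abs_apply_le hw1 hw'
    have ht : 0 < |v 0 3| ^ 5 := pow_pos (abs_pos.2 h03) 5
    have h2 : 1 / 24000 ≤ S / |v 0 3| ^ 5 := by linarith
    rw [le_div_iff₀ ht] at h2
    linarith
end

section
/- Let 𝔤 = 𝔰𝔩₄(ℝ), and let 𝔥₂ = {X ∈ 𝔤 : σ₂(X) = X} and 𝔯₂ = {X ∈ 𝔤 : σ₂(X) = −X} be the fixed and (−1)-eigenspaces of the involution σ₂(X) = −Q₂XᵀQ₂⁻¹. Then: (a) 𝔥₂ is a simple Lie algebra; (b) if W ⊆ 𝔤 is a linear subspace with {0} ≠ W ≠ 𝔤 which is invariant under the adjoint action of 𝔥₂ (i.e., [X,Y] ∈ W for all X ∈ 𝔥₂ and Y ∈ W), then W = 𝔥₂ or W = 𝔯₂. -/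
open Matrix MeasureTheory
open scoped Classical

namespace SoThreeOne

/-- The element of 𝔥₂ with the given coordinates. -/
def hMat (a m p q r s : ℝ) : M4 :=
  !![a, p, q, 0; r, 0, m, p; s, -m, 0, q; 0, r, s, -a]

/-- The element of 𝔯₂ with the given coordinates. -/
def rMat (z p q a b c r s w : ℝ) : M4 :=
  !![a, p, q, z; r, b - a, c, -p; s, c, -a - b, -q; w, -r, -s, a]

lemma hMat_add (a m p q r s a' m' p' q' r' s' : ℝ) :
    hMat a m p q r s + hMat a' m' p' q' r' s' =
      hMat (a + a') (m + m') (p + p') (q + q') (r + r') (s + s') := by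
  ext i j; fin_cases i <;> fin_cases j <;> simp [hMat] <;> ring

lemma hMat_smul (t a m p q r s : ℝ) :
    t • hMat a m p q r s = hMat (t * a) (t * m) (t * p) (t * q) (t * r) (t * s) := by
  ext i j; fin_cases i <;> fin_cases j <;> simp [hMat]

lemma rMat_add (z p q a b c r s w z' p' q' a' b' c' r' s' w' : ℝ) :
    rMat z p q a b c r s w + rMat z' p' q' a' b' c' r' s' w' =
      rMat (z + z') (p + p') (q + q') (a + a') (b + b') (c + c') (r + r') (s + s') (w + w') := by
  ext i j; fin_cases i <;> fin_cases j <;> simp [rMat] <;> ring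

lemma rMat_smul (t z p q a b c r s w : ℝ) :
    t • rMat z p q a b c r s w =
      rMat (t * z) (t * p) (t * q) (t * a) (t * b) (t * c) (t * r) (t * s) (t * w) := by
  ext i j; fin_cases i <;> fin_cases j <;> simp [rMat] <;> ring

lemma lie_hMat_hMat (a m p q r s a' m' p' q' r' s' : ℝ) :
    ⁅hMat a m p q r s, hMat a' m' p' q' r' s'⁆ =
      hMat (p * r' + q * s' - p' * r - q' * s) (r * q' - r' * q + p * s' - p' * s)
        (a * p' - a' * p - q * m' + q' * m) (a * q' - a' * q + p * m' - p' * m)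
        (r * a' - r' * a + m * s' - m' * s) (s * a' - s' * a - m * r' + m' * r) := by
  rw [Ring.lie_def]
  ext i j; fin_cases i <;> fin_cases j <;>
    simp [hMat] <;> ring

lemma lie_hMat_rMat (a m p q r s z p' q' a' b c r' s' w : ℝ) :
    ⁅hMat a m p q r s, rMat z p' q' a' b c r' s' w⁆ =
      rMat (2 * a * z - 2 * p * p' - 2 * q * q')
        (a * p' + p * b - 2 * p * a' + q * c + m * q' - z * r)
        (a * q' + p * c - 2 * q * a' - q * b - m * p' - z * s)
        (p * r' + q * s' - p' * r - q' * s)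
        (-p * r' + q * s' + p' * r - q' * s + 2 * m * c)
        (r * q' - 2 * m * b - p * s' - r' * q + p' * s)
        (2 * r * a' + m * s' + p * w - r' * a - c * s - b * r)
        (2 * s * a' - m * r' + q * w - s' * a - c * r + b * s)
        (-2 * a * w + 2 * r * r' + 2 * s * s') := by
  rw [Ring.lie_def]
  ext i j; fin_cases i <;> fin_cases j <;>
    simp [hMat, rMat] <;> ring

lemma sigmaMap_one_apply (X : M4) :
    sigmaMap 1 X =
      !![-X 3 3, X 1 3, X 2 3, -X 0 3;
         X 3 1, -X 1 1, -X 2 1, X 0 1;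
         X 3 2, -X 1 2, -X 2 2, X 0 2;
         -X 3 0, X 1 0, X 2 0, -X 0 0] := by
  have hinv : (Qmat 1)⁻¹ = Qmat 1 := by
    apply Matrix.inv_eq_left_inv
    ext i j; fin_cases i <;> fin_cases j <;>
      simp [Qmat]
  change -(Qmat 1 * Xᵀ * (Qmat 1)⁻¹) = _
  rw [hinv]
  ext i j; fin_cases i <;> fin_cases j <;>
    simp [Qmat, Matrix.mul_apply, Matrix.vecMul, dotProduct, Fin.sum_univ_four]

lemma mem_sl4_iff (X : M4) : X ∈ sl4 ↔ X 0 0 + X 1 1 + X 2 2 + X 3 3 = 0 := by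
  change X.trace = 0 ↔ _
  simp [Matrix.trace, Fin.sum_univ_four]

lemma mem_hSpace_iff (X : M4) : X ∈ hSpace 1 ↔ X ∈ sl4 ∧ sigmaMap 1 X = X := by
  simp [hSpace, sub_eq_zero]

lemma mem_rSpace_iff (X : M4) : X ∈ rSpace 1 ↔ X ∈ sl4 ∧ sigmaMap 1 X = -X := by
  simp [rSpace, add_eq_zero_iff_eq_neg]

lemma hMat_mem (a m p q r s : ℝ) : hMat a m p q r s ∈ hSpace 1 := by
  rw [mem_hSpace_iff, mem_sl4_iff, sigmaMap_one_apply]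
  refine ⟨by simp [hMat], ?_⟩
  ext i j; fin_cases i <;> fin_cases j <;> simp [hMat]

lemma rMat_mem (z p q a b c r s w : ℝ) : rMat z p q a b c r s w ∈ rSpace 1 := by
  rw [mem_rSpace_iff, mem_sl4_iff, sigmaMap_one_apply]
  refine ⟨by simp [rMat], ?_⟩
  ext i j; fin_cases i <;> fin_cases j <;> simp [rMat]

lemma exists_eq_hMat {X : M4} (hX : X ∈ hSpace 1) :
    ∃ a m p q r s, X = hMat a m p q r s := by
  rw [mem_hSpace_iff, sigmaMap_one_apply] at hX
  have h := fun i j => congrFun (congrFun hX.2 i) j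
  simp [Fin.forall_fin_succ] at h
  refine ⟨X 0 0, X 1 2, X 0 1, X 0 2, X 1 0, X 2 0, ?_⟩
  ext i j; fin_cases i <;> fin_cases j <;> simp [hMat] <;> linarith

lemma exists_eq_rMat {X : M4} (hX : X ∈ rSpace 1) :
    ∃ z p q a b c r s w, X = rMat z p q a b c r s w := by
  rw [mem_rSpace_iff, sigmaMap_one_apply, mem_sl4_iff] at hX
  have h := fun i j => congrFun (congrFun hX.2 i) j
  have ht := hX.1
  simp [Fin.forall_fin_succ] at h
  refine ⟨X 0 3, X 0 1, X 0 2, X 0 0, X 0 0 + X 1 1, X 1 2, X 1 0, X 2 0, X 3 0, ?_⟩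
  ext i j; fin_cases i <;> fin_cases j <;> simp [rMat] <;> linarith

lemma exists_add_of_mem_sl4 {X : M4} (hX : X ∈ sl4) :
    ∃ Y ∈ hSpace 1, ∃ Z ∈ rSpace 1, X = Y + Z := by
  rw [mem_sl4_iff] at hX
  refine ⟨hMat ((X 0 0 - X 3 3) / 2) ((X 1 2 - X 2 1) / 2) ((X 0 1 + X 1 3) / 2)
      ((X 0 2 + X 2 3) / 2) ((X 1 0 + X 3 1) / 2) ((X 2 0 + X 3 2) / 2), hMat_mem _ _ _ _ _ _,
    rMat (X 0 3) ((X 0 1 - X 1 3) / 2) ((X 0 2 - X 2 3) / 2) ((X 0 0 + X 3 3) / 2)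
      ((X 1 1 - X 2 2) / 2) ((X 1 2 + X 2 1) / 2) ((X 1 0 - X 3 1) / 2)
      ((X 2 0 - X 3 2) / 2) (X 3 0), rMat_mem _ _ _ _ _ _ _ _ _, ?_⟩
  ext i j; fin_cases i <;> fin_cases j <;> simp [hMat, rMat] <;> linarith

/-- The Casimir operator of 𝔥₂ for the trace form, acting on matrices by commutators. -/
def casimir (X : M4) : M4 :=
  ⁅hMat 1 0 0 0 0 0, ⁅hMat 1 0 0 0 0 0, X⁆⁆ - ⁅hMat 0 1 0 0 0 0, ⁅hMat 0 1 0 0 0 0, X⁆⁆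
    + (⁅hMat 0 0 1 0 0 0, ⁅hMat 0 0 0 0 1 0, X⁆⁆ + ⁅hMat 0 0 0 0 1 0, ⁅hMat 0 0 1 0 0 0, X⁆⁆)
    + (⁅hMat 0 0 0 1 0 0, ⁅hMat 0 0 0 0 0 1, X⁆⁆ + ⁅hMat 0 0 0 0 0 1, ⁅hMat 0 0 0 1 0 0, X⁆⁆)

lemma casimir_add (X Y : M4) : casimir (X + Y) = casimir X + casimir Y := by
  have lie_add (A B C : M4) : ⁅A, B + C⁆ = ⁅A, B⁆ + ⁅A, C⁆ := by
    simp only [Ring.lie_def]; noncomm_ring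
  simp only [casimir, lie_add]; abel

lemma casimir_of_mem_hSpace {X : M4} (hX : X ∈ hSpace 1) : casimir X = (4 : ℝ) • X := by
  obtain ⟨a, m, p, q, r, s, rfl⟩ := exists_eq_hMat hX
  simp only [casimir, lie_hMat_hMat]
  ext i j; fin_cases i <;> fin_cases j <;> simp [hMat] <;> ring

lemma casimir_of_mem_rSpace {X : M4} (hX : X ∈ rSpace 1) : casimir X = (8 : ℝ) • X := by
  obtain ⟨z, p, q, a, b, c, r, s, w, rfl⟩ := exists_eq_rMat hX
  simp only [casimir, lie_hMat_rMat]
  ext i j; fin_cases i <;> fin_cases j <;> simp [rMat] <;> ring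

/-- Invariance of a subspace under the adjoint action of 𝔥₂. -/
def AdInvariant (W : Submodule ℝ M4) : Prop :=
  ∀ X ∈ hSpace 1, ∀ Y ∈ W, ⁅X, Y⁆ ∈ W

section Invariant

variable {W : Submodule ℝ M4}


lemma casimir_mem (hW : AdInvariant W) {X : M4} (hX : X ∈ W) : casimir X ∈ W := by
  have h (a m p q r s a' m' p' q' r' s' : ℝ) :
      ⁅hMat a m p q r s, ⁅hMat a' m' p' q' r' s', X⁆⁆ ∈ W :=
    hW _ (hMat_mem _ _ _ _ _ _) _ (hW _ (hMat_mem _ _ _ _ _ _) _ hX)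
  exact W.add_mem (W.add_mem (W.sub_mem (h ..) (h ..)) (W.add_mem (h ..) (h ..)))
    (W.add_mem (h ..) (h ..))

lemma mem_of_add_mem (hW : AdInvariant W) {X Y : M4} (hX : X ∈ hSpace 1)
    (hY : Y ∈ rSpace 1) (h : X + Y ∈ W) :
    X ∈ W ∧ Y ∈ W := by
  have hc := casimir_mem hW h
  rw [casimir_add, casimir_of_mem_hSpace hX, casimir_of_mem_rSpace hY] at hc
  have hYW : Y ∈ W := by
    have := W.smul_mem (1 / 4 : ℝ) (W.sub_mem hc (W.smul_mem (4 : ℝ) h))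
    convert this using 1
    module
  exact ⟨by simpa using W.sub_mem h hYW, hYW⟩

lemma hSpace_le_of_raising_mem (hW : AdInvariant W)
    (h₁ : hMat 0 0 1 0 0 0 ∈ W) (h₂ : hMat 0 0 0 1 0 0 ∈ W) :
    hSpace 1 ≤ W := by
  have lie (a m p q r s : ℝ) {X : M4} (hX : X ∈ W) := hW _ (hMat_mem a m p q r s) X hX
  have ha := lie 0 0 0 0 (-1) 0 h₁
  have hm := lie 0 0 0 0 0 (-1) h₁
  have hr := lie 0 0 0 0 1 0 ha
  have hs := lie 0 0 0 0 0 1 ha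
  simp only [lie_hMat_hMat] at ha hm hr hs
  intro X hX
  obtain ⟨a, m, p, q, r, s, rfl⟩ := exists_eq_hMat hX
  convert W.add_mem (W.add_mem (W.add_mem (W.smul_mem a ha) (W.smul_mem m hm))
    (W.add_mem (W.smul_mem p h₁) (W.smul_mem q h₂)))
    (W.add_mem (W.smul_mem r hr) (W.smul_mem s hs)) using 1
  simp only [hMat_smul, hMat_add]
  congr 1 <;> ring

lemma hSpace_le_of_raising_ne (hW : AdInvariant W) {a m p q r s : ℝ} (hX : hMat a m p q r s ∈ W)
    (hne : p ≠ 0 ∨ q ≠ 0) : hSpace 1 ≤ W := by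
  have lie (a m p q r s : ℝ) {X : M4} (hX : X ∈ W) := hW _ (hMat_mem a m p q r s) X hX
  have hA := lie 1 0 0 0 0 0 hX
  have hAA := lie 1 0 0 0 0 0 hA
  have hY := W.smul_mem (1 / 2 : ℝ) (W.add_mem hA hAA)
  have hMY := lie 0 1 0 0 0 0 hY
  simp only [lie_hMat_hMat, hMat_smul, hMat_add] at hY hMY
  have hn : p ^ 2 + q ^ 2 ≠ 0 := by
    rcases hne with h | h <;> positivity
  apply hSpace_le_of_raising_mem hW
  · convert W.add_mem (W.smul_mem (p / (p ^ 2 + q ^ 2)) hY)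
      (W.smul_mem (q / (p ^ 2 + q ^ 2)) hMY) using 1
    simp only [hMat_smul, hMat_add]
    congr 1 <;> field_simp <;> ring
  · convert W.sub_mem (W.smul_mem (q / (p ^ 2 + q ^ 2)) hY)
      (W.smul_mem (p / (p ^ 2 + q ^ 2)) hMY) using 1
    rw [sub_eq_add_neg, ← neg_smul]
    simp only [hMat_smul, hMat_add]
    congr 1 <;> field_simp <;> ring

lemma hSpace_le_of_mem (hW : AdInvariant W) {X : M4}
    (hX : X ∈ hSpace 1) (hXW : X ∈ W) (hne : X ≠ 0) :
    hSpace 1 ≤ W := by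
  have of_levi {a m p q r s : ℝ} (h : hMat a m p q r s ∈ W) (hne : a ≠ 0 ∨ m ≠ 0) :
      hSpace 1 ≤ W := by
    have h' := hW _ (hMat_mem 0 0 1 0 0 0) _ h
    rw [lie_hMat_hMat] at h'
    exact hSpace_le_of_raising_ne hW h' (by simpa using hne)
  obtain ⟨a, m, p, q, r, s, rfl⟩ := exists_eq_hMat hX
  by_cases hpq : p ≠ 0 ∨ q ≠ 0
  · exact hSpace_le_of_raising_ne hW hXW hpq
  by_cases ham : a ≠ 0 ∨ m ≠ 0
  · exact of_levi hXW ham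
  have h' := hW _ (hMat_mem 0 0 1 0 0 0) _ hXW
  rw [lie_hMat_hMat] at h'
  refine of_levi h' ?_
  by_contra hrs
  push Not at hpq ham hrs
  obtain ⟨⟨rfl, rfl⟩, rfl, rfl⟩ := hpq, ham
  simp at hrs
  obtain ⟨rfl, rfl⟩ := hrs
  apply hne
  ext i j; fin_cases i <;> fin_cases j <;> simp [hMat]

lemma rSpace_le_of_highest_mem (hW : AdInvariant W)
    (hz : rMat 1 0 0 0 0 0 0 0 0 ∈ W) : rSpace 1 ≤ W := by
  have lie (a m p q r s : ℝ) {X : M4} (hX : X ∈ W) := hW _ (hMat_mem a m p q r s) X hX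
  have hp := lie 0 0 0 0 (-1) 0 hz
  have hq := lie 0 0 0 0 0 (-1) hz
  have hab := lie 0 0 0 0 (-1) 0 hp
  have hab' := lie 0 0 0 0 0 (-1) hq
  have hc := lie 0 0 0 0 0 1 hp
  have hr := lie 0 0 0 0 0 (-1) hc
  have hs := lie 0 0 0 0 (-1) 0 hc
  have hw := lie 0 0 0 0 (1 / 2) 0 hr
  simp only [lie_hMat_rMat] at hp hq hab hab' hc hr hs hw
  intro X hX
  obtain ⟨z, p, q, a, b, c, r, s, w, rfl⟩ := exists_eq_rMat hX
  convert W.add_mem (W.add_mem (W.add_mem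
    (W.add_mem (W.smul_mem z hz) (W.add_mem (W.smul_mem p hp) (W.smul_mem q hq)))
    (W.add_mem (W.smul_mem ((a - b) / 2) hab) (W.smul_mem ((a + b) / 2) hab')))
    (W.add_mem (W.smul_mem c hc) (W.add_mem (W.smul_mem r hr) (W.smul_mem s hs))))
    (W.smul_mem w hw) using 1
  simp only [rMat_smul, rMat_add]
  congr 1 <;> ring

lemma rMat_weight_mem (hW : AdInvariant W) {z p q a b c r s w : ℝ}
    (hX : rMat z p q a b c r s w ∈ W) (t : ℝ) :
    rMat ((2 - t) * z) ((1 - t) * p) ((1 - t) * q) (-t * a) (-t * b) (-t * c)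
      ((-1 - t) * r) ((-1 - t) * s) ((-2 - t) * w) ∈ W := by
  have h := W.add_mem (hW _ (hMat_mem 1 0 0 0 0 0) _ hX) (W.smul_mem (-t) hX)
  rw [lie_hMat_rMat, rMat_smul, rMat_add] at h
  convert h using 2 <;> ring

lemma rSpace_le_of_highest_ne (hW : AdInvariant W) {z p q a b c r s w : ℝ}
    (hX : rMat z p q a b c r s w ∈ W) (hz : z ≠ 0) : rSpace 1 ≤ W := by
  have h := W.smul_mem (1 / (24 * z)) (rMat_weight_mem hW (rMat_weight_mem hW
    (rMat_weight_mem hW (rMat_weight_mem hW hX 1) 0) (-1)) (-2))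
  rw [rMat_smul] at h
  apply rSpace_le_of_highest_mem hW
  convert h using 2
  · field_simp; norm_num
  all_goals simp

lemma rSpace_le_of_mem (hW : AdInvariant W) {X : M4}
    (hX : X ∈ rSpace 1) (hXW : X ∈ W) (hne : X ≠ 0) :
    rSpace 1 ≤ W := by
  have raise₁ {z p q a b c r s w : ℝ} (h : rMat z p q a b c r s w ∈ W) :=
    hW _ (hMat_mem 0 0 1 0 0 0) _ h
  have raise₂ {z p q a b c r s w : ℝ} (h : rMat z p q a b c r s w ∈ W) :=
    hW _ (hMat_mem 0 0 0 1 0 0) _ h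
  simp only [lie_hMat_rMat] at raise₁ raise₂
  by_contra hle
  have hz {z p q a b c r s w : ℝ} (h : rMat z p q a b c r s w ∈ W) : z = 0 := by
    by_contra h0
    exact hle (rSpace_le_of_highest_ne hW h h0)
  have hpq {z p q a b c r s w : ℝ} (h : rMat z p q a b c r s w ∈ W) : p = 0 ∧ q = 0 := by
    have h₁ := hz (raise₁ h)
    have h₂ := hz (raise₂ h)
    constructor <;> linarith
  have habc {z p q a b c r s w : ℝ} (h : rMat z p q a b c r s w ∈ W) :
      a = 0 ∧ b = 0 ∧ c = 0 := by
    have h₁ := hpq (raise₁ h)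
    have h₂ := hpq (raise₂ h)
    refine ⟨?_, ?_, ?_⟩ <;> linarith
  have hrs {z p q a b c r s w : ℝ} (h : rMat z p q a b c r s w ∈ W) : r = 0 ∧ s = 0 := by
    have h₁ := habc (raise₁ h)
    constructor <;> linarith
  obtain ⟨z, p, q, a, b, c, r, s, w, rfl⟩ := exists_eq_rMat hX
  obtain ⟨hr', -⟩ := hrs (raise₁ hXW)
  obtain ⟨rfl, rfl⟩ := hrs hXW
  obtain ⟨rfl, rfl, rfl⟩ := habc hXW
  obtain ⟨rfl, rfl⟩ := hpq hXW
  obtain rfl := hz hXW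
  obtain rfl : w = 0 := by linarith
  apply hne
  ext i j; fin_cases i <;> fin_cases j <;> simp [rMat]

lemma eq_bot_or_eq_hSpace (hW : AdInvariant W) (hle : W ≤ hSpace 1) : W = ⊥ ∨ W = hSpace 1 := by
  refine or_iff_not_imp_left.2 fun hbot => ?_
  obtain ⟨X, hX, hne⟩ := W.exists_mem_ne_zero_of_ne_bot hbot
  exact le_antisymm hle (hSpace_le_of_mem hW (hle hX) hX hne)

lemma eq_hSpace_or_eq_rSpace (hW : AdInvariant W) (hle : W ≤ sl4)
    (hbot : W ≠ ⊥) (htop : W ≠ sl4) :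
    W = hSpace 1 ∨ W = rSpace 1 := by
  have split {X : M4} (hX : X ∈ W) :
      ∃ Y ∈ hSpace 1, ∃ Z ∈ rSpace 1, X = Y + Z ∧ Y ∈ W ∧ Z ∈ W := by
    obtain ⟨Y, hY, Z, hZ, rfl⟩ := exists_add_of_mem_sl4 (hle hX)
    exact ⟨Y, hY, Z, hZ, rfl, mem_of_add_mem hW hY hZ hX⟩
  by_cases hh : hSpace 1 ≤ W
  · refine Or.inl (le_antisymm (fun X hX => ?_) hh)
    obtain ⟨Y, hY, Z, hZ, rfl, -, hZW⟩ := split hX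
    by_cases hZ0 : Z = 0
    · simpa [hZ0] using hY
    have hr := rSpace_le_of_mem hW hZ hZW hZ0
    refine absurd (le_antisymm hle fun X hX => ?_) htop
    obtain ⟨Y, hY, Z, hZ, rfl⟩ := exists_add_of_mem_sl4 hX
    exact W.add_mem (hh hY) (hr hZ)
  · have hWr : W ≤ rSpace 1 := by
      intro X hX
      obtain ⟨Y, hY, Z, hZ, rfl, hYW, -⟩ := split hX
      by_cases hY0 : Y = 0
      · simpa [hY0] using hZ
      exact absurd (hSpace_le_of_mem hW hY hYW hY0) hh
    obtain ⟨X, hX, hne⟩ := W.exists_mem_ne_zero_of_ne_bot hbot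
    exact Or.inr (le_antisymm hWr (rSpace_le_of_mem hW (hWr hX) hX hne))

end Invariant

lemma exists_lie_ne_zero : ∃ X ∈ hSpace 1, ∃ Y ∈ hSpace 1, ⁅X, Y⁆ ≠ 0 := by
  refine ⟨_, hMat_mem 1 0 0 0 0 0, _, hMat_mem 0 0 1 0 0 0, fun h => ?_⟩
  rw [lie_hMat_hMat] at h
  simpa [hMat] using congrFun (congrFun h 0) 1

end SoThreeOne

/-- 𝔥₂ ≅ 𝔰𝔬(3,1) is simple, and the only proper nontrivial
ad(𝔥₂)-invariant subspaces of 𝔰𝔩₄(ℝ) are 𝔥₂ and 𝔯₂.  Here `hSpace 1` and `rSpace 1`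
are the ±1-eigenspaces of σ₂(X) = −Q₂XᵀQ₂⁻¹, and simplicity is stated by unfolding its
definition: non-abelian, and every ideal is trivial. -/
theorem stmt15 :
    (((∃ X ∈ hSpace 1, ∃ Y ∈ hSpace 1, X * Y - Y * X ≠ 0) ∧
      ∀ I : Submodule ℝ M4, I ≤ hSpace 1 →
        (∀ X ∈ hSpace 1, ∀ Y ∈ I, X * Y - Y * X ∈ I) → I = ⊥ ∨ I = hSpace 1)) ∧
    (∀ W : Submodule ℝ M4, W ≤ sl4 → W ≠ ⊥ → W ≠ sl4 →
      (∀ X ∈ hSpace 1, ∀ Y ∈ W, X * Y - Y * X ∈ W) →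
      W = hSpace 1 ∨ W = rSpace 1) := by
  exact ⟨⟨SoThreeOne.exists_lie_ne_zero, fun _ hle hI => SoThreeOne.eq_bot_or_eq_hSpace hI hle⟩,
    fun _ hle hbot htop hW => SoThreeOne.eq_hSpace_or_eq_rSpace hW hle hbot htop⟩
end
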